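/- arXiv:2004.13116 — 2 statements merged into one kernel-verified Lean document; each statement's English description precedes it below -/
import Mathlib

section
/- For every matroid M with finite ground set E and rank d, the h-vector of the independence complex of M is nonnegative and log-concave: h_k ≥ 0 for all 0 ≤ k ≤ d, and h_{k-1}·h_{k+1} ≤ h_k² for all 0 < k < d. -/
open Polynomial

/-- The rank of a set `X` in a matroid `M`: the supremum of the cardinalities of the
independent subsets of `X`. -/
noncomputable def matroidRank {α : Type*} (M : Matroid α) (X : Set α) : ℕ :=
  sSup {m | ∃ I ⊆ X, M.Indep I ∧ I.ncard = m}

/-- The number of independent sets of cardinality `k` in the matroid `M`: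
the `k`-th entry of the f-vector of the independence complex of `M`. -/
noncomputable def indepCount {α : Type*} (M : Matroid α) (k : ℕ) : ℕ :=
  {I : Set α | M.Indep I ∧ I.ncard = k}.ncard

namespace MatroidHVector

section Functional
open scoped Classical

/-- The variable `y` of the field of Laurent series. -/
noncomputable def yvar : LaurentSeries ℝ := HahnSeries.single 1 1

/-- The inverse of the variable `y`. -/
noncomputable def yinv : LaurentSeries ℝ := HahnSeries.single (-1) 1

lemma yvar_mul_yinv : yvar * yinv = 1 := by
  simp [yvar, yinv]

lemma yinv_mul_yvar : yinv * yvar = 1 := by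
  simp [yvar, yinv]

lemma yvar_pow (k : ℕ) : yvar ^ k = HahnSeries.single (k : ℤ) 1 := by
  simp [yvar]

lemma yinv_pow (k : ℕ) : yinv ^ k = HahnSeries.single (-k : ℤ) 1 := by
  simp [yinv]

lemma one_sub_yvar_ne_zero : (1 - yvar : LaurentSeries ℝ) ≠ 0 := by
  intro h
  have := congrArg (fun x : LaurentSeries ℝ => x.coeff 0) h
  simp [yvar] at this

/-- Evaluation of polynomials at `y`. -/
noncomputable def toLaurent : ℝ[X] →+* LaurentSeries ℝ := eval₂RingHom HahnSeries.C yvar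

lemma toLaurent_X : toLaurent X = yvar := by simp [toLaurent]

lemma coeff_yinv_pow_mul_toLaurent (m : ℕ) (P : ℝ[X]) :
    (yinv ^ m * toLaurent P).coeff 0 = P.coeff m := by
  induction P using Polynomial.induction_on' with
  | add p q hp hq => simp only [map_add, mul_add, HahnSeries.coeff_add, hp, hq, coeff_add]
  | monomial k a =>
    rw [toLaurent, coe_eval₂RingHom, eval₂_monomial, yvar_pow, yinv_pow, coeff_monomial,
      HahnSeries.C_apply, HahnSeries.single_mul_single, HahnSeries.single_mul_single,
      HahnSeries.coeff_single]
    by_cases h : k = m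
    · subst h; simp
    · have : (0:ℤ) ≠ -(m:ℤ) + k := by omega
      simp [h, this]

set_option linter.unusedSectionVars false

variable {α : Type*} [Fintype α]

/-- The signed count of spanning sets above `A`. -/
noncomputable def spanningChi (N : Matroid α) (A : Finset α) : LaurentSeries ℝ :=
  ∑ S : Finset α with A ⊆ S ∧ N.Spanning S, (-1) ^ (S \ A).card

lemma spanningChi_eq_zero (N : Matroid α) (hN : N.E = Set.univ) (A : Finset α)
    (hA : ¬ N.IsFlat A) : spanningChi N A = 0 := by
  obtain ⟨e, heA, he⟩ : ∃ e, e ∈ N.closure (A : Set α) ∧ e ∉ A := by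
    by_contra! hcon
    exact hA (Matroid.isFlat_iff_closure_eq.2
      (Set.Subset.antisymm hcon (N.subset_closure _ (by simp [hN]))))
  refine Finset.sum_involution (fun S _ => if e ∈ S then S.erase e else insert e S) ?_ ?_ ?_ ?_
  · intro S hS
    by_cases heS : e ∈ S
    · have : S \ A = insert e (S.erase e \ A) := by
        ext x; by_cases hx : x = e <;> simp [hx, heS, he]
      simp only [heS, if_true]
      rw [this, Finset.card_insert_of_notMem (by simp)]
      ring
    · have : insert e S \ A = insert e (S \ A) := Finset.insert_sdiff_of_notMem _ he
      simp only [heS, if_false]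
      rw [this, Finset.card_insert_of_notMem (by simp [heS])]
      ring
  · intro S hS _ 
    by_cases heS : e ∈ S
    · simp only [heS, if_true]
      intro h
      exact absurd (h ▸ heS) (by simp)
    · simp only [heS, if_false]
      intro h
      exact heS (h ▸ Finset.mem_insert_self e S)
  · intro S hS
    simp only [Finset.mem_filter, Finset.mem_univ, true_and] at hS ⊢
    obtain ⟨h1, h2⟩ := hS
    by_cases heS : e ∈ S
    · have h3 : A ⊆ S.erase e := fun x hx => Finset.mem_erase.2 ⟨fun h => he (h ▸ hx), h1 hx⟩
      simp only [heS, if_true]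
      refine ⟨h3, ?_⟩
      rw [Matroid.spanning_iff_closure_eq (by simp [hN])] at h2 ⊢
      rw [← h2]
      have h4 : e ∈ N.closure (S.erase e : Set α) :=
        N.closure_subset_closure (by exact_mod_cast h3) heA
      rw [← Matroid.closure_insert_eq_of_mem_closure h4]
      congr 1
      rw [← Finset.coe_insert, Finset.insert_erase heS]
    · simp only [heS, if_false]
      exact ⟨h1.trans (Finset.subset_insert _ _), h2.superset (by simp) (by simp [hN])⟩
  · intro S hS
    by_cases heS : e ∈ S <;> simp [heS]

/-- The flats of a matroid, as finsets. -/
abbrev FlatSet (N : Matroid α) := {F : Finset α // N.IsFlat (F : Set α)}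

/-- The ring of functions on the flats of `N`. -/
abbrev FlatRing (N : Matroid α) := FlatSet N → LaurentSeries ℝ

variable (N : Matroid α)

/-- The weight of a set in the degree functional. -/
noncomputable def flatWeight (c : ℕ) (A : Finset α) : LaurentSeries ℝ :=
  yinv * yvar ^ c * (1 - yvar)⁻¹ ^ c * spanningChi N A * yvar ^ (Fintype.card α - A.card)

/-- The class `s_e`. -/
noncomputable def sCls (e : α) : FlatRing N := fun F => if e ∈ F.1 then yinv - 1 else 0

/-- The class `b_e`. -/
noncomputable def bCls (e : α) : FlatRing N := fun F => if e ∈ F.1 then 1 else yinv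

/-- The class `δ`. -/
noncomputable def dCls : FlatRing N := fun _ => yinv

/-- The product of the classes `s_e` for `e ∈ B`. -/
noncomputable def sProd (B : Finset α) : FlatRing N :=
  fun F => if B ⊆ F.1 then (yinv - 1) ^ B.card else 0

/-- The product of the classes `b_e` for `e ∈ J`. -/
noncomputable def bProd (J : Finset α) : FlatRing N := fun F => yinv ^ (J \ F.1).card

lemma sCls_add_bCls (e : α) : sCls N e + bCls N e = dCls N := by
  funext F; by_cases h : e ∈ F.1 <;> simp [sCls, bCls, dCls, h]

lemma sProd_insert {e : α} {B : Finset α} (he : e ∉ B) :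
    sProd N (insert e B) = sProd N B * sCls N e := by
  funext F
  by_cases h : e ∈ F.1 <;> by_cases h2 : B ⊆ F.1 <;>
    simp [sProd, sCls, h, h2, Finset.insert_subset_iff, Finset.card_insert_of_notMem he, pow_succ]

lemma bProd_insert {e : α} {J : Finset α} (he : e ∉ J) :
    bProd N (insert e J) = bProd N J * bCls N e := by
  funext F
  by_cases h : e ∈ F.1
  · simp [bProd, bCls, h, Finset.insert_sdiff_of_mem]
  · simp [bProd, bCls, h, Finset.insert_sdiff_of_notMem, he, pow_succ]

variable {N}

lemma subset_flat_of_subset {B : Finset α} (F : FlatSet N) (hB : B ⊆ F.1) :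
    N.closure (B : Set α) ⊆ (F.1 : Set α) := by
  rw [← F.2.closure]
  exact N.closure_subset_closure (by exact_mod_cast hB)

lemma sProd_mul_sCls_of_mem_closure {B : Finset α} {e : α} (he : e ∈ N.closure (B : Set α)) :
    sProd N B * sCls N e = sProd N B * (dCls N - 1) := by
  funext F
  by_cases h2 : B ⊆ F.1
  · have : e ∈ F.1 := subset_flat_of_subset F h2 he
    simp [sProd, sCls, dCls, this]
  · simp [sProd, h2]

lemma sProd_mul_bCls_of_mem_closure {B : Finset α} {e : α} (he : e ∈ N.closure (B : Set α)) :
    sProd N B * bCls N e = sProd N B := by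
  funext F
  by_cases h2 : B ⊆ F.1
  · have : e ∈ F.1 := subset_flat_of_subset F h2 he
    simp [sProd, bCls, this]
  · simp [sProd, h2]

lemma sProd_mul_sCls_congr (hN : N.E = Set.univ) {B : Finset α} {e g : α}
    (h : N.closure (insert e B : Set α) = N.closure (insert g B : Set α)) :
    sProd N B * sCls N e = sProd N B * sCls N g := by
  funext F
  by_cases h2 : B ⊆ F.1
  · have key : ∀ e g, N.closure (insert e B : Set α) = N.closure (insert g B : Set α) →
        e ∈ F.1 → g ∈ F.1 := by
      intro e g h he
      have := subset_flat_of_subset (B := insert e B) F (Finset.insert_subset he h2)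
      rw [Finset.coe_insert, h] at this
      exact this (N.mem_closure_of_mem (Set.mem_insert _ _) (by simp [hN]))
    have : e ∈ F.1 ↔ g ∈ F.1 := ⟨key e g h, key g e h.symm⟩
    simp [sCls, this]
  · simp [sProd, h2]

variable (N)

/-- The degree functional. -/
noncomputable def flatDegree (c : ℕ) : FlatRing N →ₗ[LaurentSeries ℝ] LaurentSeries ℝ :=
  ∑ F : FlatSet N, flatWeight N c F.1 • LinearMap.proj F

lemma flatDegree_apply (c : ℕ) (X : FlatRing N) :
    flatDegree N c X = ∑ F : FlatSet N, flatWeight N c F.1 * X F := by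
  simp [flatDegree]

lemma sum_powerset_aux {B J S : Finset α} (hBS : B ⊆ S) (hBJ : Disjoint B J) :
    ∑ A ∈ S.powerset, (-1) ^ (S \ A).card * yvar ^ (Fintype.card α - A.card) *
      ((if B ⊆ A then (yinv - 1) ^ B.card else 0) * yinv ^ (J \ A).card) =
    if Disjoint S J then
      yinv ^ (B.card + J.card) * (1 - yvar) ^ S.card * yvar ^ (Fintype.card α - S.card) else 0 := by
  set g : α → LaurentSeries ℝ := fun e =>
    (if e ∈ B then 0 else 1) * (-yvar) * (if e ∈ J then yinv else 1) with hg
  have h1 : ∀ A ∈ S.powerset, (-1) ^ (S \ A).card * yvar ^ (Fintype.card α - A.card) *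
      ((if B ⊆ A then (yinv - 1) ^ B.card else 0) * yinv ^ (J \ A).card) =
      ((yinv - 1) ^ B.card * yvar ^ (Fintype.card α - S.card) * yinv ^ (J \ S).card) *
      ((∏ e ∈ A, 1) * ∏ e ∈ S \ A, g e) := by
    intro A hA
    rw [Finset.mem_powerset] at hA
    have e1 : ∏ e ∈ S \ A, g e = (if B ⊆ A then 1 else 0) * (-yvar) ^ (S \ A).card *
        yinv ^ ((S \ A) ∩ J).card := by
      simp only [hg, Finset.prod_mul_distrib, Finset.prod_const]
      congr 1
      · congr 1
        by_cases h : B ⊆ A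
        · rw [if_pos h]
          refine Finset.prod_eq_one fun e he => ?_
          rw [if_neg]
          exact fun h' => (Finset.mem_sdiff.1 he).2 (h h')
        · rw [if_neg h]
          obtain ⟨e, heB, heA⟩ := Finset.not_subset.1 h
          exact Finset.prod_eq_zero (Finset.mem_sdiff.2 ⟨hBS heB, heA⟩) (by simp [heB])
      · rw [Finset.prod_ite]
        simp [Finset.filter_mem_eq_inter]
    have e2 : Fintype.card α - A.card = (Fintype.card α - S.card) + (S \ A).card := by
      rw [Finset.card_sdiff_of_subset hA]
      have := Finset.card_le_card hA
      have := Finset.card_le_univ S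
      omega
    have e3 : (J \ A).card = (J \ S).card + ((S \ A) ∩ J).card := by
      rw [← Finset.card_union_of_disjoint]
      · congr 1
        ext x
        have := @hA x
        simp only [Finset.mem_sdiff, Finset.mem_union, Finset.mem_inter]
        tauto
      · rw [Finset.disjoint_left]
        intro x hx hx'
        simp only [Finset.mem_sdiff, Finset.mem_inter] at hx hx'
        tauto
    rw [e1, e2, e3, neg_pow yvar]
    by_cases h : B ⊆ A
    · simp [h]
      ring
    · simp [h]
  rw [Finset.sum_congr rfl h1, ← Finset.mul_sum, ← Finset.prod_add]
  by_cases hd : Disjoint S J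
  · rw [if_pos hd]
    have e4 : J \ S = J := Finset.sdiff_eq_self_of_disjoint hd.symm
    have e5 : ∏ i ∈ S, (1 + g i) = (1 - yvar) ^ (S.card - B.card) := by
      rw [← Finset.card_sdiff_of_subset hBS, ← Finset.prod_sdiff hBS]
      have a1 : ∏ x ∈ B, (1 + g x) = 1 :=
        Finset.prod_eq_one fun x hx => by simp [hg, hx]
      have a2 : ∏ x ∈ S \ B, (1 + g x) = ∏ x ∈ S \ B, (1 - yvar) := by
        refine Finset.prod_congr rfl fun x hx => ?_
        rw [Finset.mem_sdiff] at hx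
        have : x ∉ J := Finset.disjoint_left.1 hd hx.1
        simp [hg, hx.2, this, sub_eq_add_neg]
      rw [a1, a2]; simp
    have e6 : (yinv - 1 : LaurentSeries ℝ) = yinv * (1 - yvar) := by
      rw [mul_sub, yinv_mul_yvar, mul_one]
    have e7 : S.card = B.card + (S.card - B.card) := by
      have := Finset.card_le_card hBS; omega
    rw [e4, e5, e6, mul_pow]
    conv_rhs => rw [e7, pow_add (1 - yvar), ← e7]
    ring
  · rw [if_neg hd]
    obtain ⟨x, hxS, hxJ⟩ := Finset.not_disjoint_iff.1 hd
    have hxB : x ∉ B := fun h => Finset.disjoint_left.1 hBJ h hxJ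
    rw [Finset.prod_eq_zero hxS, mul_zero]
    simp only [hg, hxB, hxJ, if_true, if_false, one_mul]
    linear_combination (-1 : LaurentSeries ℝ) * yvar_mul_yinv

/-- The polynomial counting spanning sets above `B` and disjoint from `J`. -/
noncomputable def spanPoly (c : ℕ) (B J : Finset α) : ℝ[X] :=
  ∑ S : Finset α with B ⊆ S ∧ Disjoint S J ∧ N.Spanning S,
    X ^ (Fintype.card α - S.card) * (1 - X) ^ (S.card - c)

lemma flatDegree_sProd_mul_bProd (hN : N.E = Set.univ) (c : ℕ)
    (hc : ∀ S : Finset α, N.Spanning S → c ≤ S.card) {B J : Finset α} (hBJ : Disjoint B J) :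
    flatDegree N c (sProd N B * bProd N J) =
      yinv ^ (B.card + J.card + 1) * yvar ^ c * toLaurent (spanPoly N c B J) := by
  rw [flatDegree_apply]
  have h0 : ∑ F : FlatSet N, flatWeight N c F.1 * (sProd N B * bProd N J) F =
      ∑ A : Finset α, flatWeight N c A *
        ((if B ⊆ A then (yinv - 1) ^ B.card else 0) * yinv ^ (J \ A).card) := by
    rw [← Finset.sum_subset (Finset.subset_univ (Finset.univ.filter
      fun A : Finset α => N.IsFlat (A : Set α)))]
    · exact (Finset.sum_subtype (Finset.univ.filter
        fun A : Finset α => N.IsFlat (A : Set α)) (by simp) (fun A => flatWeight N c A *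
        ((if B ⊆ A then (yinv - 1) ^ B.card else 0) * yinv ^ (J \ A).card))).symm
    · intro A _ hA
      rw [flatWeight, spanningChi_eq_zero N hN A (by simpa using hA)]
      simp
  rw [h0]
  have h1 : ∀ A : Finset α, flatWeight N c A *
        ((if B ⊆ A then (yinv - 1) ^ B.card else 0) * yinv ^ (J \ A).card) =
      ∑ S : Finset α, if N.Spanning S ∧ B ⊆ S ∧ A ⊆ S then yinv * yvar ^ c * (1 - yvar)⁻¹ ^ c *
        ((-1) ^ (S \ A).card * yvar ^ (Fintype.card α - A.card) *
      ((if B ⊆ A then (yinv - 1) ^ B.card else 0) * yinv ^ (J \ A).card)) else 0 := by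
    intro A
    rw [flatWeight, spanningChi, Finset.sum_filter, Finset.mul_sum, Finset.sum_mul, Finset.sum_mul]
    refine Finset.sum_congr rfl fun S _ => ?_
    by_cases h1 : A ⊆ S
    · by_cases h2 : N.Spanning S
      · by_cases h3 : B ⊆ S
        · simp only [h1, h2, h3, and_self, if_true]; ring
        · have : ¬ B ⊆ A := fun h => h3 (h.trans h1)
          simp [h3, this]
      · simp [h2]
    · simp [h1]
  simp_rw [h1]
  rw [Finset.sum_comm, spanPoly, map_sum, Finset.mul_sum, Finset.sum_filter]
  refine Finset.sum_congr rfl fun S _ => ?_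
  by_cases h2 : N.Spanning S
  · by_cases h3 : B ⊆ S
    · have h4 := sum_powerset_aux h3 hBJ
      simp only [h2, h3, true_and, and_true]
      rw [← Finset.sum_filter, ← Finset.mul_sum]
      have : (Finset.univ.filter fun A : Finset α => A ⊆ S) = S.powerset := by ext; simp
      rw [this, h4]
      by_cases hd : Disjoint S J
      · rw [if_pos hd, if_pos hd]
        simp only [map_mul, map_pow, map_sub, map_one, toLaurent_X]
        have e7 : S.card = c + (S.card - c) := by have := hc S h2; omega
        conv_lhs => rw [e7, pow_add (1 - yvar), ← e7]
        have e8 : (1 - yvar : LaurentSeries ℝ)⁻¹ ^ c * (1 - yvar) ^ c = 1 := by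
          rw [← mul_pow, inv_mul_cancel₀ one_sub_yvar_ne_zero, one_pow]
        linear_combination (yinv * yvar ^ c * yinv ^ (B.card + J.card) *
          (1 - yvar) ^ (S.card - c) * yvar ^ (Fintype.card α - S.card)) * e8
      · simp [hd]
    · simp [h3]
  · simp [h2]

end Functional

section Model
open scoped Classical
set_option linter.unusedSectionVars false
variable {α : Type*} [Fintype α]

/-- The linear forms spanned by `1`, `δ` and the classes `s_e`. -/
def linearForms {R : Type*} [CommRing R] [Algebra ℝ R] (s : α → R) (δ : R) : Submodule ℝ R :=
  Submodule.span ℝ (insert 1 (insert δ (Set.range s)))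

/-- An algebra carrying the degree functionals attached to the independent sets of `N`. -/
structure DegreeModel (N : Matroid α) (c : ℕ) (R : Type*) [CommRing R] [Algebra ℝ R] where
  /-- The class `s_e`. -/
  s : α → R
  /-- The class `b_e`. -/
  b : α → R
  /-- The class `δ`. -/
  δ : R
  /-- The degree functional of the state `(B, J)`. -/
  ψ : Finset α → Finset α → R →ₗ[ℝ] ℝ
  s_add_b : ∀ e, s e + b e = δ
  ψ_s : ∀ {e : α} {B : Finset α} (J X), e ∉ B → ψ B J (s e * X) = ψ (insert e B) J X
  ψ_b : ∀ {e} (B) {J} (X), e ∉ J → ψ B J (b e * X) = ψ B (insert e J) X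
  ψ_s_of_mem_closure : ∀ {e : α} {B : Finset α} (J X), e ∈ N.closure (B : Set α) →
    ψ B J (s e * X) = ψ B J (δ * X) - ψ B J X
  ψ_b_of_mem_closure : ∀ {e : α} {B : Finset α} (J X), e ∈ N.closure (B : Set α) →
    ψ B J (b e * X) = ψ B J X
  ψ_s_congr : ∀ {e g : α} {B : Finset α} (J X),
    N.closure (insert e B : Set α) = N.closure (insert g B : Set α) →
    ψ B J (s e * X) = ψ B J (s g * X)
  ψ_eq_zero : ∀ {B J : Finset α} {q X}, N.Indep (B : Set α) →
    (∀ e, e ∉ N.closure (B : Set α) → e ∈ J) →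
    X ∈ linearForms s δ ^ q → ψ B J X = 0
  ψ_one : ∀ {B J : Finset α}, N.Indep (B : Set α) → (∃ e, e ∉ N.closure (B : Set α) ∧ e ∉ J) →
    ψ B J 1 = if B.card + 1 = c then 1 else 0

/-- A copy of the ring of functions on the flats, with its own real algebra structure. -/
def FlatAlg (N : Matroid α) : Type _ := FlatRing N

noncomputable instance (N : Matroid α) : CommRing (FlatAlg N) :=
  inferInstanceAs (CommRing (FlatRing N))

noncomputable instance (N : Matroid α) : Algebra ℝ (FlatAlg N) :=
  RingHom.toAlgebra (R := ℝ) (S := FlatAlg N)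
    ((Pi.constRingHom (FlatSet N) (LaurentSeries ℝ)).comp HahnSeries.C)

variable (N : Matroid α)

variable {N} in
/-- The underlying function on flats. -/
def FlatAlg.val (X : FlatAlg N) : FlatRing N := X

/-- The class `s_e` as an element of `FlatAlg N`. -/
noncomputable def FlatAlg.s (e : α) : FlatAlg N := sCls N e

/-- The class `b_e` as an element of `FlatAlg N`. -/
noncomputable def FlatAlg.b (e : α) : FlatAlg N := bCls N e

/-- The class `δ` as an element of `FlatAlg N`. -/
noncomputable def FlatAlg.δ : FlatAlg N := dCls N

/-- The degree of `X` in the state `(B, J)`. -/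
noncomputable def stateDegree (c : ℕ) (B J : Finset α) (X : FlatAlg N) : LaurentSeries ℝ :=
  flatDegree N c (sProd N B * bProd N J * X.val)

lemma stateDegree_add (c : ℕ) (B J : Finset α) (X Y : FlatAlg N) :
    stateDegree N c B J (X + Y) = stateDegree N c B J X + stateDegree N c B J Y := by
  unfold stateDegree
  rw [← map_add, ← mul_add]; rfl

lemma stateDegree_of_val_eq_smul (c : ℕ) (B J : Finset α) (r : LaurentSeries ℝ) {X Y : FlatAlg N}
    (h : ∀ F, Y.val F = r * X.val F) :
    stateDegree N c B J Y = r * stateDegree N c B J X := by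
  unfold stateDegree
  have h : sProd N B * bProd N J * Y.val = r • (sProd N B * bProd N J * X.val) := by
    funext F
    simp only [Pi.mul_apply, Pi.smul_apply, smul_eq_mul, h]
    ring
  rw [h, map_smul, smul_eq_mul]

lemma stateDegree_smul (c : ℕ) (B J : Finset α) (r : ℝ) (X : FlatAlg N) :
    stateDegree N c B J (r • X) = HahnSeries.C r * stateDegree N c B J X :=
  stateDegree_of_val_eq_smul N c B J _ fun F => by rw [Algebra.smul_def]; rfl

lemma stateDegree_δ_mul (c : ℕ) (B J : Finset α) (X : FlatAlg N) :
    stateDegree N c B J (FlatAlg.δ N * X) = yinv * stateDegree N c B J X :=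
  stateDegree_of_val_eq_smul N c B J _ fun _ => rfl

lemma stateDegree_congr (c : ℕ) {B J B' J' : Finset α} {X Y : FlatAlg N}
    (h : sProd N B * bProd N J * X.val = sProd N B' * bProd N J' * Y.val) :
    stateDegree N c B J X = stateDegree N c B' J' Y :=
  congrArg (flatDegree N c) h

lemma stateDegree_s_mul (c : ℕ) {e : α} {B : Finset α} (J : Finset α) (X : FlatAlg N)
    (he : e ∉ B) :
    stateDegree N c B J (FlatAlg.s N e * X) = stateDegree N c (insert e B) J X := by
  apply stateDegree_congr
  rw [sProd_insert N he]
  change sProd N B * bProd N J * (sCls N e * X.val) = _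
  ring

lemma stateDegree_b_mul (c : ℕ) {e : α} (B : Finset α) {J : Finset α} (X : FlatAlg N)
    (he : e ∉ J) :
    stateDegree N c B J (FlatAlg.b N e * X) = stateDegree N c B (insert e J) X := by
  apply stateDegree_congr
  rw [bProd_insert N he]
  change sProd N B * bProd N J * (bCls N e * X.val) = _
  ring

lemma stateDegree_b_mul_of_mem_closure (c : ℕ) {e : α} {B : Finset α} (J : Finset α)
    (X : FlatAlg N) (he : e ∈ N.closure (B : Set α)) :
    stateDegree N c B J (FlatAlg.b N e * X) = stateDegree N c B J X := by
  apply stateDegree_congr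
  change sProd N B * bProd N J * (bCls N e * X.val) = _
  linear_combination (bProd N J * X.val) * sProd_mul_bCls_of_mem_closure he

lemma stateDegree_s_mul_of_mem_closure (c : ℕ) {e : α} {B : Finset α} (J : Finset α)
    (X : FlatAlg N) (he : e ∈ N.closure (B : Set α)) :
    stateDegree N c B J (FlatAlg.s N e * X) =
      yinv * stateDegree N c B J X - stateDegree N c B J X := by
  rw [eq_sub_iff_add_eq, ← stateDegree_δ_mul, ← stateDegree_add]
  apply stateDegree_congr
  change sProd N B * bProd N J * (sCls N e * X.val + X.val) =
    sProd N B * bProd N J * (dCls N * X.val)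
  linear_combination (bProd N J * X.val) * sProd_mul_sCls_of_mem_closure he

lemma stateDegree_s_mul_congr (hN : N.E = Set.univ) (c : ℕ) {e g : α} {B : Finset α}
    (J : Finset α) (X : FlatAlg N)
    (h : N.closure (insert e B : Set α) = N.closure (insert g B : Set α)) :
    stateDegree N c B J (FlatAlg.s N e * X) = stateDegree N c B J (FlatAlg.s N g * X) := by
  apply stateDegree_congr
  change sProd N B * bProd N J * (sCls N e * X.val) = sProd N B * bProd N J * (sCls N g * X.val)
  linear_combination (bProd N J * X.val) * sProd_mul_sCls_congr hN h

lemma sProd_mul_bProd_sdiff (B J : Finset α) :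
    sProd N B * bProd N (J \ B) = sProd N B * bProd N J := by
  funext F
  by_cases h : B ⊆ F.1
  · have : (J \ B) \ F.1 = J \ F.1 := by
      ext x
      have := @h x
      simp only [Finset.mem_sdiff]
      tauto
    simp [bProd, this]
  · simp [sProd, h]

variable {N}

lemma card_le_of_indep {c : ℕ} (hc : ∀ B : Finset α, N.IsBase (B : Set α) → B.card = c)
    {B : Finset α} (hB : N.Indep (B : Set α)) : B.card ≤ c := by
  obtain ⟨B', hB', h⟩ := hB.exists_isBase_superset
  rw [← hc B'.toFinset (by simpa using hB')]
  exact Finset.card_le_card (fun x hx => by simpa using h hx)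

lemma card_le_of_spanning {c : ℕ} (hc : ∀ B : Finset α, N.IsBase (B : Set α) → B.card = c)
    {S : Finset α} (hS : N.Spanning (S : Set α)) : c ≤ S.card := by
  obtain ⟨B', hB', h⟩ := hS.exists_isBase_subset
  rw [← hc B'.toFinset (by simpa using hB')]
  exact Finset.card_le_card (fun x hx => by simpa using h (by simpa using hx))

lemma insert_indep (hN : N.E = Set.univ) {B : Finset α} {e : α} (hB : N.Indep (B : Set α))
    (he : e ∉ N.closure (B : Set α)) : N.Indep (insert e B : Finset α) := by
  rw [Finset.coe_insert, hB.insert_indep_iff]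
  exact Or.inl ⟨by simp [hN], he⟩

lemma notMem_of_notMem_closure (hN : N.E = Set.univ) {B : Finset α} {e : α}
    (he : e ∉ N.closure (B : Set α)) : e ∉ B :=
  fun h => he (N.mem_closure_of_mem (by exact_mod_cast h) (by simp [hN]))

lemma card_lt_of_notMem_closure (hN : N.E = Set.univ) {c : ℕ}
    (hc : ∀ B : Finset α, N.IsBase (B : Set α) → B.card = c) {B : Finset α} {e : α}
    (hB : N.Indep (B : Set α)) (he : e ∉ N.closure (B : Set α)) : B.card + 1 ≤ c := by
  rw [← Finset.card_insert_of_notMem (notMem_of_notMem_closure hN he)]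
  exact card_le_of_indep hc (insert_indep hN hB he)

lemma coeff_stateDegree_one (hN : N.E = Set.univ) {c : ℕ}
    (hc : ∀ B : Finset α, N.IsBase (B : Set α) → B.card = c) (B J : Finset α) :
    stateDegree N c B J 1 = yinv ^ (B.card + (J \ B).card + 1) *
      toLaurent (X ^ c * spanPoly N c B (J \ B)) := by
  have : stateDegree N c B J 1 = flatDegree N c (sProd N B * bProd N (J \ B)) := by
    rw [sProd_mul_bProd_sdiff]
    exact congrArg (flatDegree N c) (mul_one (sProd N B * bProd N J))
  rw [this, flatDegree_sProd_mul_bProd N hN c (fun S hS => card_le_of_spanning hc hS)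
    Finset.disjoint_sdiff, map_mul, map_pow, toLaurent_X]
  ring

lemma stateDegree_one_of_exists (hN : N.E = Set.univ) {c : ℕ}
    (hc : ∀ B : Finset α, N.IsBase (B : Set α) → B.card = c) {B J : Finset α}
    (hB : N.Indep (B : Set α)) (hT : ∃ e, e ∉ N.closure (B : Set α) ∧ e ∉ J) :
    (stateDegree N c B J 1).coeff 0 = if B.card + 1 = c then 1 else 0 := by
  obtain ⟨e, he, heJ⟩ := hT
  have hlt := card_lt_of_notMem_closure hN hc hB he
  have hcompl : ∀ S : Finset α, Disjoint S (J \ B) →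
      (J \ B).card ≤ Fintype.card α - S.card ∧
      ((J \ B).card = Fintype.card α - S.card → S = (J \ B)ᶜ) := by
    intro S hS
    have h1 : S ⊆ (J \ B)ᶜ := by
      intro x hx; rw [Finset.mem_compl]; exact Finset.disjoint_left.1 hS hx
    have h2 := Finset.card_le_card h1
    have h3 := Finset.card_compl_add_card (J \ B)
    refine ⟨by omega, fun h => Finset.eq_of_subset_of_card_le h1 ?_⟩
    have := Finset.card_le_univ S
    omega
  rw [coeff_stateDegree_one hN hc, coeff_yinv_pow_mul_toLaurent, spanPoly, Finset.mul_sum,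
    finsetSum_coeff]
  split_ifs with h
  · rw [Finset.sum_eq_single (J \ B)ᶜ]
    · have h3 := Finset.card_compl_add_card (J \ B)
      rw [← mul_assoc, ← pow_add, coeff_X_pow_mul', if_pos (by omega)]
      have : B.card + (J \ B).card + 1 - (c + (Fintype.card α - (J \ B)ᶜ.card)) = 0 := by omega
      rw [this, coeff_zero_eq_eval_zero]
      simp
    · intro S hS hne
      simp only [Finset.mem_filter, Finset.mem_univ, true_and] at hS
      have := hcompl S hS.2.1
      rw [← mul_assoc, ← pow_add, coeff_X_pow_mul', if_neg]
      intro h'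
      exact hne (this.2 (by omega))
    · intro hS
      exfalso
      apply hS
      simp only [Finset.mem_filter, Finset.mem_univ, true_and]
      refine ⟨fun x hx => by simp [hx], ?_, ?_⟩
      · rw [Finset.disjoint_left]; intro x hx; simpa using hx
      · have hi : N.IsBase (insert e B : Finset α) := by
          have h1 := insert_indep hN hB he
          obtain ⟨B', hB', h2⟩ := h1.exists_isBase_superset
          have h3 : insert e B = B'.toFinset := by
            apply Finset.eq_of_subset_of_card_le (fun x hx => by simpa using h2 hx)
            rw [hc _ (by simpa using hB'),
              Finset.card_insert_of_notMem (notMem_of_notMem_closure hN he), h]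
          rw [h3]; simpa using hB'
        refine hi.spanning.superset ?_ (by simp [hN])
        intro x hx
        simp only [Finset.coe_insert, Set.mem_insert_iff, Finset.mem_coe] at hx
        rcases hx with rfl | hx
        · simp [heJ]
        · simp [hx]
  · refine Finset.sum_eq_zero fun S hS => ?_
    simp only [Finset.mem_filter, Finset.mem_univ, true_and] at hS
    have := hcompl S hS.2.1
    rw [← mul_assoc, ← pow_add, coeff_X_pow_mul', if_neg]
    omega

/-- Laurent series all of whose terms have negative exponent. -/
def IsPolar (k : LaurentSeries ℝ) : Prop := ∀ j : ℤ, 0 ≤ j → k.coeff j = 0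

lemma IsPolar.add {k l : LaurentSeries ℝ} (hk : IsPolar k) (hl : IsPolar l) : IsPolar (k + l) :=
  fun j hj => by rw [HahnSeries.coeff_add, hk j hj, hl j hj, add_zero]

lemma IsPolar.sub {k l : LaurentSeries ℝ} (hk : IsPolar k) (hl : IsPolar l) : IsPolar (k - l) :=
  fun j hj => by rw [HahnSeries.coeff_sub, hk j hj, hl j hj, sub_zero]

lemma IsPolar.const_mul {k : LaurentSeries ℝ} (hk : IsPolar k) (r : ℝ) :
    IsPolar (HahnSeries.C r * k) :=
  fun j hj => by rw [HahnSeries.C_mul_eq_smul, HahnSeries.coeff_smul, hk j hj, smul_zero]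

lemma IsPolar.yinv_mul {k : LaurentSeries ℝ} (hk : IsPolar k) : IsPolar (yinv * k) := by
  intro j hj
  have := HahnSeries.coeff_single_mul_add (r := (1 : ℝ)) (x := k) (a := j + 1) (b := (-1 : ℤ))
  rw [show j + 1 + -1 = j by ring] at this
  rw [yinv, this, hk (j + 1) (by omega), mul_zero]

lemma flatWeight_univ (hN : N.E = Set.univ) (c : ℕ) :
    flatWeight N c Finset.univ * (yinv - 1) ^ c = yinv := by
  have h2 : spanningChi N Finset.univ = 1 := by
    rw [spanningChi, Finset.sum_eq_single Finset.univ]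
    · simp
    · intro S hS hne
      simp only [Finset.mem_filter, Finset.univ_subset_iff] at hS
      exact absurd hS.2.1 hne
    · intro h
      exfalso
      apply h
      have := N.ground_spanning
      rw [hN] at this
      simpa using this
  have h3 : (yvar * (1 - yvar)⁻¹ * (yinv - 1) : LaurentSeries ℝ) = 1 := by
    have : (1 - yvar : LaurentSeries ℝ)⁻¹ * (1 - yvar) = 1 :=
      inv_mul_cancel₀ one_sub_yvar_ne_zero
    linear_combination (1 - yvar : LaurentSeries ℝ)⁻¹ * yvar_mul_yinv + this
  have h4 : (yvar * (1 - yvar)⁻¹ * (yinv - 1) : LaurentSeries ℝ) ^ c = 1 := by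
    rw [h3, one_pow]
  rw [mul_pow, mul_pow] at h4
  rw [flatWeight, h2, Finset.card_univ, Nat.sub_self, pow_zero, mul_one, mul_one]
  linear_combination yinv * h4

lemma stateDegree_one_of_isBase (hN : N.E = Set.univ) {c : ℕ} {B : Finset α} (J : Finset α)
    (hB : N.IsBase (B : Set α)) (hc : B.card = c) : stateDegree N c B J 1 = yinv := by
  have hflat : N.IsFlat ((Finset.univ : Finset α) : Set α) := by
    rw [Finset.coe_univ, ← hN]; exact N.ground_isFlat
  unfold stateDegree
  rw [flatDegree_apply, Finset.sum_eq_single ⟨Finset.univ, hflat⟩]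
  · have : (sProd N B * bProd N J * FlatAlg.val (1 : FlatAlg N) : FlatRing N) ⟨Finset.univ, hflat⟩ =
        (yinv - 1) ^ c := by
      change sProd N B _ * bProd N J _ * 1 = _
      have hJ : J \ Finset.univ = ∅ := by ext; simp
      simp [sProd, bProd, hJ, hc]
    rw [this]
    exact flatWeight_univ hN c
  · intro F _ hF
    have : ¬ B ⊆ F.1 := by
      intro h
      apply hF
      have h5 := subset_flat_of_subset F h
      rw [hB.closure_eq, hN] at h5
      apply Subtype.ext
      ext x
      simpa using h5 (Set.mem_univ x)
    have h0 : sProd N B F = 0 := by simp [sProd, this]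
    rw [Pi.mul_apply, Pi.mul_apply, h0, zero_mul, zero_mul, mul_zero]
  · exact fun h => absurd (Finset.mem_univ _) h

lemma isPolar_stateDegree_one (hN : N.E = Set.univ) {c : ℕ}
    (hc : ∀ B : Finset α, N.IsBase (B : Set α) → B.card = c) {B J : Finset α}
    (hB : N.Indep (B : Set α)) (hT : ∀ e, e ∉ N.closure (B : Set α) → e ∈ J) :
    IsPolar (stateDegree N c B J 1) := by
  by_cases hs : N.closure (B : Set α) = Set.univ
  · have hbase : N.IsBase (B : Set α) :=
      Matroid.isBase_iff_indep_closure_eq.2 ⟨hB, by rw [hs, hN]⟩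
    rw [stateDegree_one_of_isBase hN J hbase (hc B hbase)]
    intro j hj
    rw [yinv, HahnSeries.coeff_single, if_neg (by omega)]
  · have : spanPoly N c B (J \ B) = 0 := by
      unfold spanPoly
      rw [Finset.sum_filter]
      refine Finset.sum_eq_zero fun S _ => if_neg ?_
      rintro ⟨h1, h2, h3⟩
      apply hs
      have h4 : (S : Set α) ⊆ N.closure (B : Set α) := by
        intro x hx
        by_contra hx'
        have : x ∈ J \ B := Finset.mem_sdiff.2 ⟨hT x hx', notMem_of_notMem_closure hN hx'⟩
        exact Finset.disjoint_left.1 h2 (by exact_mod_cast hx) this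
      have h5 := N.closure_subset_closure_of_subset_closure h4
      rw [h3.closure_eq, hN] at h5
      exact Set.univ_subset_iff.1 h5
    rw [coeff_stateDegree_one hN hc, this]
    intro j _
    simp

lemma isPolar_stateDegree (hN : N.E = Set.univ) {c : ℕ}
    (hc : ∀ B : Finset α, N.IsBase (B : Set α) → B.card = c) {q : ℕ} {X : FlatAlg N}
    (hX : X ∈ linearForms (FlatAlg.s N) (FlatAlg.δ N) ^ q) :
    ∀ {B J : Finset α}, N.Indep (B : Set α) → (∀ e, e ∉ N.closure (B : Set α) → e ∈ J) →
    IsPolar (stateDegree N c B J X) := by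
  refine Submodule.pow_induction_on_left' _
    (C := fun _ X _ => ∀ {B J : Finset α}, N.Indep (B : Set α) →
      (∀ e, e ∉ N.closure (B : Set α) → e ∈ J) → IsPolar (stateDegree N c B J X)) ?_ ?_ ?_ hX
  · intro r B J hB hT
    rw [Algebra.algebraMap_eq_smul_one, stateDegree_smul]
    exact (isPolar_stateDegree_one hN hc hB hT).const_mul r
  · intro x y i hx hy h1 h2 B J hB hT
    rw [stateDegree_add]
    exact (h1 hB hT).add (h2 hB hT)
  · intro m hm i x hx h B J hB hT
    induction hm using Submodule.span_induction with
    | mem m hm =>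
      rcases hm with rfl | rfl | ⟨e, rfl⟩
      · rw [one_mul]; exact h hB hT
      · rw [stateDegree_δ_mul]; exact (h hB hT).yinv_mul
      · by_cases he : e ∈ N.closure (B : Set α)
        · rw [stateDegree_s_mul_of_mem_closure N c J x he]
          exact (h hB hT).yinv_mul.sub (h hB hT)
        · rw [stateDegree_s_mul N c J x (notMem_of_notMem_closure hN he)]
          refine h (insert_indep hN hB he) fun g hg => hT g fun hg' => hg ?_
          exact N.closure_subset_closure (by simp) hg'
    | zero => 
      have : stateDegree N c B J (0 * x) = HahnSeries.C 0 * stateDegree N c B J x := by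
        rw [← stateDegree_smul, zero_smul, zero_mul]
      rw [this]
      exact (h hB hT).const_mul 0
    | add u v _ _ hu hv => rw [add_mul, stateDegree_add]; exact hu.add hv
    | smul r u _ hu => rw [smul_mul_assoc, stateDegree_smul]; exact hu.const_mul r

/-- The degree model given by the ring of functions on the flats of `N`. -/
noncomputable def flatModel (hN : N.E = Set.univ) {c : ℕ}
    (hc : ∀ B : Finset α, N.IsBase (B : Set α) → B.card = c) : DegreeModel N c (FlatAlg N) where
  s := FlatAlg.s N
  b := FlatAlg.b N
  δ := FlatAlg.δ N
  ψ B J :=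
    { toFun := fun X => (stateDegree N c B J X).coeff 0
      map_add' := fun X Y => by rw [stateDegree_add, HahnSeries.coeff_add]
      map_smul' := fun r X => by
        rw [stateDegree_smul, HahnSeries.C_mul_eq_smul, HahnSeries.coeff_smul]; rfl }
  s_add_b := sCls_add_bCls N
  ψ_s J X he := congrArg (fun k : LaurentSeries ℝ => k.coeff 0) (stateDegree_s_mul N c J X he)
  ψ_b B J X he := congrArg (fun k : LaurentSeries ℝ => k.coeff 0) (stateDegree_b_mul N c B X he)
  ψ_s_of_mem_closure J X he := by
    change (stateDegree N c _ J _).coeff 0 = (stateDegree N c _ J _).coeff 0 - _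
    rw [stateDegree_s_mul_of_mem_closure N c J X he, stateDegree_δ_mul,
      HahnSeries.coeff_sub]; rfl
  ψ_b_of_mem_closure J X he := congrArg (fun k : LaurentSeries ℝ => k.coeff 0)
    (stateDegree_b_mul_of_mem_closure N c J X he)
  ψ_s_congr J X h := congrArg (fun k : LaurentSeries ℝ => k.coeff 0)
    (stateDegree_s_mul_congr N hN c J X h)
  ψ_eq_zero hB hT hX := isPolar_stateDegree hN hc hX hB hT 0 le_rfl
  ψ_one hB hT := stateDegree_one_of_exists hN hc hB hT

lemma flatModel_ψ_dCls_pow (hN : N.E = Set.univ) {c : ℕ}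
    (hc : ∀ B : Finset α, N.IsBase (B : Set α) → B.card = c) (a : ℕ) :
    (flatModel hN hc).ψ ∅ ∅ ((flatModel hN hc).δ ^ a) =
      (X ^ c * spanPoly N c ∅ ∅).coeff (a + 1) := by
  have h : ∀ a, stateDegree N c ∅ ∅ (FlatAlg.δ N ^ a) =
      yinv ^ a * stateDegree N c ∅ ∅ 1 := by
    intro a
    induction a with
    | zero => rw [pow_zero, pow_zero, one_mul]
    | succ a ih => rw [pow_succ', stateDegree_δ_mul, ih, pow_succ']; ring
  change (stateDegree N c ∅ ∅ (FlatAlg.δ N ^ a)).coeff 0 = _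
  rw [h, coeff_stateDegree_one hN hc, ← coeff_yinv_pow_mul_toLaurent, ← mul_assoc, ← pow_add]
  rfl

end Model

section Spectral
variable {ι : Type*} [Fintype ι]

open Matrix in
/-- A real symmetric matrix whose nonpositive eigenvectors are the only ones not orthogonal to `v`
is nonpositive at `v`. -/
lemma dotProduct_mulVec_nonpos [DecidableEq ι] {S : Matrix ι ι ℝ} (hS : S.IsHermitian)
    (v : ι → ℝ)
    (h : ∀ (t : ℝ) (e : ι → ℝ), e ≠ 0 → S *ᵥ e = t • e → t ≤ 0 ∨ e ⬝ᵥ v = 0) :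
    v ⬝ᵥ S *ᵥ v ≤ 0 := by
  have hsymm : Sᵀ = S := by
    ext i j
    simpa using hS.apply i j
  have key : v ⬝ᵥ S *ᵥ v =
      ∑ k, hS.eigenvalues k * ((hS.eigenvectorBasis k).ofLp ⬝ᵥ v) ^ 2 := by
    have h1 := hS.eigenvectorBasis.sum_inner_mul_inner (WithLp.toLp 2 v) (WithLp.toLp 2 (S *ᵥ v))
    have h2 : inner ℝ (WithLp.toLp 2 v) (WithLp.toLp 2 (S *ᵥ v)) = v ⬝ᵥ S *ᵥ v := by
      rw [EuclideanSpace.inner_eq_star_dotProduct]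
      simp [dotProduct_comm]
    rw [← h2, ← h1]
    refine Finset.sum_congr rfl fun k _ => ?_
    rw [EuclideanSpace.inner_eq_star_dotProduct, EuclideanSpace.inner_eq_star_dotProduct]
    simp only [star_trivial]
    have h3 : S *ᵥ v ⬝ᵥ (hS.eigenvectorBasis k).ofLp =
        hS.eigenvalues k * ((hS.eigenvectorBasis k).ofLp ⬝ᵥ v) := by
      rw [dotProduct_comm, dotProduct_mulVec, ← mulVec_transpose, hsymm,
        hS.mulVec_eigenvectorBasis, smul_dotProduct, smul_eq_mul]
    rw [h3]; ring
  rw [key]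
  refine Finset.sum_nonpos fun k _ => ?_
  have hne : (hS.eigenvectorBasis k).ofLp ≠ 0 := by
    intro h0
    apply hS.eigenvectorBasis.toBasis.ne_zero k
    ext i
    simpa using congrFun h0 i
  rcases h _ _ hne (hS.mulVec_eigenvectorBasis k) with h | h
  · exact mul_nonpos_of_nonpos_of_nonneg h (sq_nonneg _)
  · rw [h]; simp

lemma laplacian_identity {A : ι → ι → ℝ} {c m : ι → ℝ}
    (hA : ∀ i j, A i j = A j i) (hc : ∀ i, 0 < c i)
    (hm : ∀ i, ∑ j, A i j * c j = m i * c i) (u : ι → ℝ) :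
    ∑ i, ∑ j, A i j * c i * c j * (u i / c i - u j / c j) ^ 2 =
      2 * (∑ i, m i * u i ^ 2 - ∑ i, ∑ j, A i j * u i * u j) := by
  have h1 : ∀ i j, A i j * c i * c j * (u i / c i - u j / c j) ^ 2 =
      u i ^ 2 / c i * (A i j * c j) + u j ^ 2 / c j * (A j i * c i) - 2 * (A i j * u i * u j) := by
    intro i j
    rw [hA j i]
    have := (hc i).ne'; have := (hc j).ne'
    field_simp
    ring
  have h2 : ∀ i, ∑ j, u i ^ 2 / c i * (A i j * c j) = m i * u i ^ 2 := by
    intro i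
    rw [← Finset.mul_sum, hm]
    have := (hc i).ne'
    field_simp
  simp only [h1, Finset.sum_add_distrib, Finset.sum_sub_distrib, h2, ← Finset.mul_sum]
  have h3 : ∑ i, ∑ j, u j ^ 2 / c j * (A j i * c i) = ∑ i, m i * u i ^ 2 := by
    rw [Finset.sum_comm]
    exact Finset.sum_congr rfl fun i _ => h2 i
  rw [h3]; ring

open Matrix in
/-- The spectral form of the Bochner method. -/
lemma bochner_nonpos {A : ι → ι → ℝ} {c m : ι → ℝ}
    (hA : ∀ i j, A i j = A j i) (hc : ∀ i, 0 < c i) (hmpos : ∀ i, 0 < m i)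
    (hm : ∀ i, ∑ j, A i j * c j = m i * c i)
    (hoff : ∀ i j, i ≠ j → 0 ≤ A i j)
    (hconn : ∀ f : ι → ℝ, (∀ i j, 0 < A i j → f i = f j) → ∀ i j, f i = f j)
    (hB : ∀ u : ι → ℝ, ∑ i, ∑ j, A i j * u i * u j ≤ ∑ j, (∑ i, A j i * u i) ^ 2 / m j)
    (u : ι → ℝ) (hu : ∑ i, m i * c i * u i = 0) : ∑ i, ∑ j, A i j * u i * u j ≤ 0 := by
  classical
  set r : ι → ℝ := fun i => √(m i)
  have hr : ∀ i, 0 < r i := fun i => Real.sqrt_pos.2 (hmpos i)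
  have hr2 : ∀ i, r i * r i = m i := fun i => Real.mul_self_sqrt (hmpos i).le
  let S : Matrix ι ι ℝ := fun i j => A i j / (r i * r j)
  have hS : S.IsHermitian := by
    ext i j
    change A j i / (r j * r i) = A i j / (r i * r j)
    rw [hA, mul_comm]
  have hmain := dotProduct_mulVec_nonpos hS (fun i => r i * u i) ?_
  · refine le_of_eq_of_le ?_ hmain
    simp only [dotProduct, mulVec, S, Finset.mul_sum]
    refine Finset.sum_congr rfl fun i _ => Finset.sum_congr rfl fun j _ => ?_
    have := (hr i).ne'; have := (hr j).ne'
    field_simp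
  intro t e he0 he
  by_contra! hcon
  obtain ⟨ht, hdot⟩ := hcon
  let x : ι → ℝ := fun i => e i / r i
  have hx : ∀ i, ∑ j, A i j * x j = t * m i * x i := by
    intro i
    have := congrFun he i
    simp only [mulVec, dotProduct, S, Pi.smul_apply, smul_eq_mul] at this
    have h1 : ∑ j, A i j * x j = r i * ∑ j, A i j / (r i * r j) * e j := by
      rw [Finset.mul_sum]
      refine Finset.sum_congr rfl fun j _ => ?_
      have := (hr i).ne'; have := (hr j).ne'
      simp only [x]
      field_simp
    rw [h1, this, ← hr2]
    have := (hr i).ne'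
    simp only [x]
    field_simp
  have hpos : 0 < ∑ i, m i * x i ^ 2 := by
    obtain ⟨i, hi⟩ := Function.ne_iff.1 he0
    refine Finset.sum_pos' (fun i _ => mul_nonneg (hmpos i).le (sq_nonneg _))
      ⟨i, Finset.mem_univ i, mul_pos (hmpos i) ?_⟩
    have : x i ≠ 0 := div_ne_zero (by simpa using hi) (hr i).ne'
    positivity
  have hxx : ∑ i, ∑ j, A i j * x i * x j = t * ∑ i, m i * x i ^ 2 := by
    rw [Finset.mul_sum]
    refine Finset.sum_congr rfl fun i _ => ?_
    have : ∑ j, A i j * x i * x j = x i * ∑ j, A i j * x j := by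
      rw [Finset.mul_sum]; exact Finset.sum_congr rfl fun j _ => by ring
    rw [this, hx]; ring
  have ht1 : 1 ≤ t := by
    have := hB x
    rw [hxx] at this
    have h2 : ∑ j, (∑ i, A j i * x i) ^ 2 / m j = t ^ 2 * ∑ i, m i * x i ^ 2 := by
      rw [Finset.mul_sum]
      refine Finset.sum_congr rfl fun i _ => ?_
      rw [hx]
      have := (hmpos i).ne'
      field_simp
    rw [h2] at this
    have h3 := le_of_mul_le_mul_right this hpos
    nlinarith
  have hterm : ∀ i j, 0 ≤ A i j * c i * c j * (x i / c i - x j / c j) ^ 2 := by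
    intro i j
    by_cases hij : i = j
    · subst hij; simp
    · have := hoff i j hij; have := hc i; have := hc j; positivity
  have hlap := laplacian_identity hA hc hm x
  rw [hxx] at hlap
  have hzero : ∑ i, ∑ j, A i j * c i * c j * (x i / c i - x j / c j) ^ 2 ≤ 0 := by
    rw [hlap]; nlinarith
  have hall : ∀ i j, A i j * c i * c j * (x i / c i - x j / c j) ^ 2 = 0 := by
    have h0 := le_antisymm hzero
      (Finset.sum_nonneg fun i _ => Finset.sum_nonneg fun j _ => hterm i j)
    rw [Finset.sum_eq_zero_iff_of_nonneg fun i _ => Finset.sum_nonneg fun j _ => hterm i j] at h0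
    intro i j
    have h1 := h0 i (Finset.mem_univ i)
    rw [Finset.sum_eq_zero_iff_of_nonneg fun j _ => hterm i j] at h1
    exact h1 j (Finset.mem_univ j)
  have hconst := hconn (fun i => x i / c i) (fun i j hij => by
    have h1 := hall i j
    have h2 : A i j * c i * c j ≠ 0 := (mul_pos (mul_pos hij (hc i)) (hc j)).ne'
    have h3 := (mul_eq_zero.1 h1).resolve_left h2
    linarith [pow_eq_zero_iff (two_ne_zero) |>.1 h3])
  apply hdot
  obtain ⟨i₀, -⟩ := Function.ne_iff.1 he0
  have h5 : ∀ i, e i = x i₀ / c i₀ * (r i * c i) := by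
    intro i
    rw [← hconst i i₀]
    have := (hr i).ne'; have := (hc i).ne'
    simp only [x]
    field_simp
  have h6 : e ⬝ᵥ (fun i => r i * u i) = x i₀ / c i₀ * ∑ i, m i * c i * u i := by
    simp only [dotProduct, Finset.mul_sum]
    refine Finset.sum_congr rfl fun i _ => ?_
    rw [h5, ← hr2]; ring
  rw [h6, hu, mul_zero]

end Spectral

section Lorentz

/-- A quadratic form nonpositive on the orthogonal complement of `w` satisfies the reverse
Cauchy–Schwarz inequality at `w`. -/
lemma reverse_cauchySchwarz_of_nonpos {R : Type*} [CommRing R] [Algebra ℝ R] (L : R →ₗ[ℝ] ℝ)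
    (W : Submodule ℝ R) {Y w : R} (hw : w ∈ W) (hpos : 0 < L (Y * (w * w)))
    (h : ∀ u ∈ W, L (Y * (w * u)) = 0 → L (Y * (u * u)) ≤ 0) {u : R} (hu : u ∈ W) :
    L (Y * (u * u)) * L (Y * (w * w)) ≤ L (Y * (w * u)) ^ 2 := by
  set t := L (Y * (w * u)) / L (Y * (w * w)) with ht
  have e1 : Y * (w * (u - t • w)) = Y * (w * u) - t • (Y * (w * w)) := by
    simp only [Algebra.smul_def]; ring
  have e2 : Y * ((u - t • w) * (u - t • w)) =
      Y * (u * u) - (2 * t) • (Y * (w * u)) + (t ^ 2) • (Y * (w * w)) := by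
    simp only [Algebra.smul_def, map_mul, map_pow, map_ofNat]; ring
  have h1 := h (u - t • w) (sub_mem hu (W.smul_mem t hw)) (by
    rw [e1, map_sub, map_smul, smul_eq_mul, ht, div_mul_cancel₀ _ hpos.ne', sub_self])
  rw [e2, map_add, map_sub, map_smul, map_smul, smul_eq_mul, smul_eq_mul] at h1
  have h2 : t * L (Y * (w * w)) = L (Y * (w * u)) := div_mul_cancel₀ _ hpos.ne'
  rw [← h2] at h1 ⊢
  nlinarith

end Lorentz

section Forms
open scoped Classical
set_option linter.unusedSectionVars false
variable {α : Type*} [Fintype α] {N : Matroid α} {c : ℕ} {R : Type*} [CommRing R] [Algebra ℝ R]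

/-- The state `(B, J)` is live if some element outside the closure of `B` is not in `J`. -/
def Live (N : Matroid α) (B J : Finset α) : Prop := ∃ e, e ∉ N.closure (B : Set α) ∧ e ∉ J

lemma subset_closure_insert (B : Finset α) (e : α) :
    N.closure (B : Set α) ⊆ N.closure ((insert e B : Finset α) : Set α) :=
  N.closure_subset_closure (by simp)

lemma mem_closure_insert_self (hN : N.E = Set.univ) (B : Finset α) (e : α) :
    e ∈ N.closure ((insert e B : Finset α) : Set α) :=
  N.mem_closure_of_mem (by simp) (by simp [hN])

lemma closure_insert_eq {B : Finset α} {e g : α} (hg : g ∉ N.closure (B : Set α))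
    (h : g ∈ N.closure ((insert e B : Finset α) : Set α)) :
    N.closure ((insert g B : Finset α) : Set α) = N.closure ((insert e B : Finset α) : Set α) := by
  rw [Finset.coe_insert] at *
  rw [Finset.coe_insert]
  exact Matroid.closure_insert_congr ⟨h, hg⟩

lemma exists_notMem_closure (hN : N.E = Set.univ)
    (hc : ∀ B : Finset α, N.IsBase (B : Set α) → B.card = c) {B : Finset α}
    (hB : N.Indep (B : Set α)) (h : B.card < c) : ∃ e, e ∉ N.closure (B : Set α) := by
  by_contra! hall
  have : N.IsBase (B : Set α) :=
    Matroid.isBase_iff_indep_closure_eq.2 ⟨hB, by rw [hN]; exact Set.eq_univ_of_forall hall⟩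
  have := hc B this
  omega

lemma card_insert (hN : N.E = Set.univ) {B : Finset α} {e : α}
    (he : e ∉ N.closure (B : Set α)) : (insert e B).card = B.card + 1 :=
  Finset.card_insert_of_notMem (notMem_of_notMem_closure hN he)

namespace DegreeModel
variable (D : DegreeModel N c R)

/-- The space of linear forms of the model. -/
abbrev V : Submodule ℝ R := linearForms D.s D.δ

lemma one_mem : (1 : R) ∈ D.V := Submodule.subset_span (by simp)
lemma δ_mem : D.δ ∈ D.V := Submodule.subset_span (by simp)
lemma s_mem (e : α) : D.s e ∈ D.V := Submodule.subset_span (by simp)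
lemma b_eq (e : α) : D.b e = D.δ - D.s e := by rw [← D.s_add_b e]; ring
lemma b_mem (e : α) : D.b e ∈ D.V := by
  rw [D.b_eq]; exact sub_mem D.δ_mem (D.s_mem e)

lemma mul_mem_pow {u X : R} {q : ℕ} (hu : u ∈ D.V) (hX : X ∈ D.V ^ q) : u * X ∈ D.V ^ (q + 1) := by
  rw [pow_succ']; exact Submodule.mul_mem_mul hu hX

lemma mul_mem_two {u v : R} (hu : u ∈ D.V) (hv : v ∈ D.V) : u * v ∈ D.V ^ 2 := by
  rw [pow_two]; exact Submodule.mul_mem_mul hu hv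

lemma one_mem_pow : (1 : R) ∈ D.V ^ 0 := by
  rw [pow_zero]; exact Submodule.one_le.1 le_rfl

lemma pow_mem {w : R} (hw : w ∈ D.V) (q : ℕ) : w ^ q ∈ D.V ^ q := Submodule.pow_mem_pow _ hw _

lemma ψ_s' (hN : N.E = Set.univ) {e : α} {B : Finset α} (J : Finset α) (X : R)
    (he : e ∉ N.closure (B : Set α)) : D.ψ B J (D.s e * X) = D.ψ (insert e B) J X :=
  D.ψ_s J X (notMem_of_notMem_closure hN he)

lemma ψ_δ (hN : N.E = Set.univ) {f : α} {B J : Finset α} (X : R)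
    (hf : f ∉ N.closure (B : Set α)) (hfJ : f ∉ J) :
    D.ψ B J (D.δ * X) = D.ψ B (insert f J) X + D.ψ (insert f B) J X := by
  rw [← D.s_add_b f, add_mul, map_add, D.ψ_s' hN J X hf, D.ψ_b B X hfJ, add_comm]

lemma ψ_one_of_live {B J : Finset α} (hB : N.Indep (B : Set α)) (h : Live N B J)
    (hBc : B.card + 1 = c) : D.ψ B J 1 = 1 := by rw [D.ψ_one hB h, if_pos hBc]

/-- Degrees vanish on states that are not live. -/
lemma ψ_eq_zero_of_not_live {B J : Finset α} (hB : N.Indep (B : Set α)) (h : ¬ Live N B J)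
    {q : ℕ} {X : R} (hX : X ∈ D.V ^ q) : D.ψ B J X = 0 := by
  refine D.ψ_eq_zero hB (fun e he => ?_) hX
  by_contra hJ
  exact h ⟨e, he, hJ⟩

/-- Degrees vanish in low degree. -/
lemma ψ_eq_zero_of_lt (hN : N.E = Set.univ) {q : ℕ} {X : R} (hX : X ∈ D.V ^ q) :
    ∀ {B J : Finset α}, N.Indep (B : Set α) → q + 1 + B.card < c → D.ψ B J X = 0 := by
  refine Submodule.pow_induction_on_left' _
    (C := fun q X _ => ∀ {B J : Finset α}, N.Indep (B : Set α) → q + 1 + B.card < c →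
      D.ψ B J X = 0) ?_ ?_ ?_ hX
  · intro r B J hB hlt
    rw [Algebra.algebraMap_eq_smul_one, map_smul]
    by_cases hL : Live N B J
    · rw [D.ψ_one hB hL, if_neg (by omega), smul_zero]
    · rw [D.ψ_eq_zero_of_not_live hB hL D.one_mem_pow, smul_zero]
  · intro x y i hx hy h1 h2 B J hB hlt
    rw [map_add, h1 hB hlt, h2 hB hlt, add_zero]
  · intro m hm i x hx h B J hB hlt
    have hins : ∀ {e : α} (J : Finset α), e ∉ N.closure (B : Set α) → D.ψ (insert e B) J x = 0 :=
      fun {e} J he => h (insert_indep hN hB he) (by rw [card_insert hN he]; omega)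
    have hδ : D.ψ B J (D.δ * x) = 0 := by
      by_cases hL : Live N B J
      · obtain ⟨f, hf, hfJ⟩ := hL
        rw [D.ψ_δ hN x hf hfJ, hins _ hf, h hB (by omega), add_zero]
      · exact D.ψ_eq_zero_of_not_live hB hL (D.mul_mem_pow D.δ_mem hx)
    induction hm using Submodule.span_induction with
    | mem m hm =>
      rcases hm with rfl | rfl | ⟨e, rfl⟩
      · rw [one_mul]; exact h hB (by omega)
      · exact hδ
      · by_cases he : e ∈ N.closure (B : Set α)
        · rw [D.ψ_s_of_mem_closure J x he, hδ, h hB (by omega), sub_zero]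
        · rw [D.ψ_s' hN J x he, hins _ he]
    | zero => rw [zero_mul, map_zero]
    | add u v _ _ hu hv => rw [add_mul, map_add, hu, hv, add_zero]
    | smul r u _ hu => rw [smul_mul_assoc, map_smul, hu, smul_zero]

/-- The linear form with the given coordinates in `1`, `δ` and `1 + s_e`. -/
noncomputable def form (a d : ℝ) (x : α → ℝ) : R :=
  a • (1 : R) + d • D.δ + ∑ e, x e • (1 + D.s e)

lemma form_mem (a d : ℝ) (x : α → ℝ) : D.form a d x ∈ D.V :=
  add_mem (add_mem (D.V.smul_mem _ D.one_mem) (D.V.smul_mem _ D.δ_mem))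
    (sum_mem fun e _ => D.V.smul_mem _ (add_mem D.one_mem (D.s_mem e)))

lemma exists_form {u : R} (hu : u ∈ D.V) : ∃ a d x, u = D.form a d x := by
  induction hu using Submodule.span_induction with
  | mem m hm =>
    rcases hm with rfl | rfl | ⟨e, rfl⟩
    · exact ⟨1, 0, 0, by simp [form]⟩
    · exact ⟨0, 1, 0, by simp [form]⟩
    · exact ⟨-1, 0, Pi.single e 1, by
      simp [form, Pi.single_apply, ite_smul, Finset.sum_add_distrib]⟩
  | zero => exact ⟨0, 0, 0, by simp [form]⟩
  | add u v _ _ hu hv =>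
    obtain ⟨a, d, x, rfl⟩ := hu
    obtain ⟨a', d', x', rfl⟩ := hv
    refine ⟨a + a', d + d', x + x', ?_⟩
    simp only [form, Pi.add_apply, add_smul, Finset.sum_add_distrib]
    abel
  | smul r u _ hu =>
    obtain ⟨a, d, x, rfl⟩ := hu
    refine ⟨r * a, r * d, r • x, ?_⟩
    simp only [form, Pi.smul_apply, smul_eq_mul, mul_smul, smul_add, Finset.smul_sum]

/-- The action of a linear form in the state `(B, J)`. -/
lemma ψ_form_mul (B J : Finset α) (a d : ℝ) (x : α → ℝ) (X : R) :
    D.ψ B J (D.form a d x * X) =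
      (a + ∑ e with e ∉ N.closure (B : Set α), x e) * D.ψ B J X +
      (d + ∑ e with e ∈ N.closure (B : Set α), x e) * D.ψ B J (D.δ * X) +
      ∑ e with e ∉ N.closure (B : Set α), x e * D.ψ B J (D.s e * X) := by
  have h : ∀ e, D.ψ B J ((1 + D.s e) * X) =
      if e ∉ N.closure (B : Set α) then D.ψ B J X + D.ψ B J (D.s e * X)
      else D.ψ B J (D.δ * X) := by
    intro e
    rw [add_mul, one_mul, map_add]
    split_ifs with he
    · rw [D.ψ_s_of_mem_closure J X he]; ring
    · rfl
  simp only [form, add_mul, smul_mul_assoc, one_mul, Finset.sum_mul, map_add, map_smul, map_sum,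
    smul_eq_mul]
  have h2 : ∑ e, x e * D.ψ B J ((1 + D.s e) * X) =
      ∑ e with e ∉ N.closure (B : Set α), x e * (D.ψ B J X + D.ψ B J (D.s e * X)) +
      ∑ e with e ∈ N.closure (B : Set α), x e * D.ψ B J (D.δ * X) := by
    rw [Finset.sum_filter, Finset.sum_filter, ← Finset.sum_add_distrib]
    refine Finset.sum_congr rfl fun e _ => ?_
    rw [h]
    by_cases he : e ∈ N.closure (B : Set α) <;> simp [he]
  simp only [add_mul, one_mul, map_add] at h2
  rw [h2]
  simp only [mul_add, Finset.sum_add_distrib, ← Finset.sum_mul]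
  ring

/-- The action of a linear form in a live state, in terms of `b_f`. -/
lemma ψ_form_mul_of_live {B J : Finset α} {f : α}
    (hf : f ∉ N.closure (B : Set α)) (a d : ℝ) (x : α → ℝ) (X : R) :
    D.ψ B J (D.form a d x * X) =
      (a + ∑ e with e ∉ N.closure (B : Set α), x e) * D.ψ B J X +
      (d + ∑ e with e ∈ N.closure (B : Set α), x e) * D.ψ B J (D.b f * X) +
      ∑ e with e ∉ N.closure (B : Set α),
        (x e + if e = f then d + ∑ e with e ∈ N.closure (B : Set α), x e else 0) *
          D.ψ B J (D.s e * X) := by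
  rw [ψ_form_mul, ← D.s_add_b f]
  simp only [add_mul _ _ (D.ψ _ _ _), Finset.sum_add_distrib, ite_mul, zero_mul]
  rw [Finset.sum_ite_eq_of_mem' _ _ _ (by simpa using hf)]
  rw [add_mul, map_add]
  ring

end DegreeModel

/-- Coordinates of a form in the open cone. -/
structure PosCoord (a d : ℝ) (x : α → ℝ) : Prop where
  a_pos : 0 < a
  d_pos : 0 < d
  x_pos : ∀ e, 0 < x e

lemma live_of_live_insert {B J : Finset α} {e : α}
    (h : Live N (insert e B) J) : Live N B J :=
  h.imp fun _ hg => ⟨fun h' => hg.1 (subset_closure_insert B e h'), hg.2⟩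

lemma exists_live_insert (hN : N.E = Set.univ)
    (hc : ∀ B : Finset α, N.IsBase (B : Set α) → B.card = c) {B J : Finset α}
    (hB : N.Indep (B : Set α)) (h : Live N B J) (hBc : B.card + 1 < c) :
    ∃ e, e ∉ N.closure (B : Set α) ∧ Live N (insert e B) J := by
  obtain ⟨f, hf, hfJ⟩ := h
  obtain ⟨e, he⟩ := exists_notMem_closure hN hc (insert_indep hN hB hf)
    (by rw [card_insert hN hf]; omega)
  have he' : e ∉ N.closure (B : Set α) := fun h => he (subset_closure_insert B f h)
  refine ⟨e, he', f, fun h => he ?_, hfJ⟩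
  rw [closure_insert_eq hf h]
  exact mem_closure_insert_self hN B e

namespace DegreeModel
variable (D : DegreeModel N c R)

lemma ψ_pow_form (hN : N.E = Set.univ)
    (hc : ∀ B : Finset α, N.IsBase (B : Set α) → B.card = c) {a d : ℝ} {x : α → ℝ}
    (hx : PosCoord a d x) (q : ℕ) : ∀ {B J : Finset α}, N.Indep (B : Set α) →
    0 ≤ D.ψ B J (D.form a d x ^ q) ∧
    (Live N B J → c ≤ q + 1 + B.card → 0 < D.ψ B J (D.form a d x ^ q)) := by
  have hreduce : ∀ {q : ℕ} {B J : Finset α}, N.Indep (B : Set α) →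
      (Live N B J → c ≤ q + 1 + B.card → 0 < D.ψ B J (D.form a d x ^ q)) →
      0 ≤ D.ψ B J (D.form a d x ^ q) := by
    intro q B J hB h
    by_cases hL : Live N B J
    · by_cases hq : c ≤ q + 1 + B.card
      · exact (h hL hq).le
      · rw [D.ψ_eq_zero_of_lt hN (D.pow_mem (D.form_mem a d x) q) hB (by omega)]
    · rw [D.ψ_eq_zero_of_not_live hB hL (D.pow_mem (D.form_mem a d x) q)]
  induction q with
  | zero =>
    intro B J hB
    suffices h : _ from ⟨hreduce hB h, h⟩
    rintro ⟨f, hf, hfJ⟩ hle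
    have := card_lt_of_notMem_closure hN hc hB hf
    rw [pow_zero, D.ψ_one_of_live hB ⟨f, hf, hfJ⟩ (by omega)]
    exact one_pos
  | succ q ih =>
    intro B J hB
    suffices h : _ from ⟨hreduce hB h, h⟩
    rintro hL hle
    have hL' := hL
    obtain ⟨f, hf, hfJ⟩ := hL'
    have h1 : 0 < a + ∑ e with e ∉ N.closure (B : Set α), x e :=
      add_pos_of_pos_of_nonneg hx.a_pos (Finset.sum_nonneg fun e _ => (hx.x_pos e).le)
    have h2 : 0 < d + ∑ e with e ∈ N.closure (B : Set α), x e :=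
      add_pos_of_pos_of_nonneg hx.d_pos (Finset.sum_nonneg fun e _ => (hx.x_pos e).le)
    have h3 : 0 ≤ D.ψ B J (D.form a d x ^ q) := (ih hB).1
    have h4 : 0 ≤ D.ψ B J (D.δ * D.form a d x ^ q) := by
      rw [D.ψ_δ hN _ hf hfJ]
      exact add_nonneg (ih hB).1 (ih (insert_indep hN hB hf)).1
    have h5 : ∀ e, e ∉ N.closure (B : Set α) →
        0 ≤ x e * D.ψ B J (D.s e * D.form a d x ^ q) := by
      intro e he
      rw [D.ψ_s' hN J _ he]
      exact mul_nonneg (hx.x_pos e).le (ih (insert_indep hN hB he)).1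
    have h5' : 0 ≤ ∑ e with e ∉ N.closure (B : Set α),
        x e * D.ψ B J (D.s e * D.form a d x ^ q) :=
      Finset.sum_nonneg fun e he => h5 e (by simpa using he)
    rw [pow_succ', ψ_form_mul]
    by_cases hq : c ≤ q + 1 + B.card
    · have := mul_pos h1 ((ih hB).2 hL hq)
      have := mul_nonneg h2.le h4
      linarith
    · obtain ⟨e, he, hLe⟩ := exists_live_insert hN hc hB hL (by omega)
      have h6 : 0 < ∑ e with e ∉ N.closure (B : Set α),
          x e * D.ψ B J (D.s e * D.form a d x ^ q) := by
        refine Finset.sum_pos' (fun e he => h5 e (by simpa using he))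
          ⟨e, by simpa using he, ?_⟩
        rw [D.ψ_s' hN J _ he]
        exact mul_pos (hx.x_pos e) ((ih (insert_indep hN hB he)).2 hLe
          (by rw [card_insert hN he]; omega))
      have := mul_nonneg h1.le h3
      have := mul_nonneg h2.le h4
      linarith

end DegreeModel
end Forms

section Step
open scoped Classical
set_option linter.unusedSectionVars false
variable {α : Type*} [Fintype α] {N : Matroid α} {c : ℕ} {R : Type*} [CommRing R] [Algebra ℝ R]

/-- Every function factors through a choice of representatives of its fibres. -/
lemma exists_representatives {β : Type*} (K : α → β) :
    ∃ r : α → α, (∀ e, K (r e) = K e) ∧ ∀ e g, K e = K g → r e = r g := by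
  refine ⟨fun e => (show ∃ g, K g = K e from ⟨e, rfl⟩).choose,
    fun e => (show ∃ g, K g = K e from ⟨e, rfl⟩).choose_spec, fun e g h => ?_⟩
  simp only [h]

lemma live_insert_insert {B J : Finset α} {e g t : α}
    (he : Live N (insert e B) J) (h : ¬ Live N (insert g (insert e B)) J)
    (ht : t ∉ N.closure ((insert g (insert e B) : Finset α) : Set α)) (hN : N.E = Set.univ) :
    Live N (insert t (insert e B)) J := by
  obtain ⟨x, hx, hxJ⟩ := he
  refine ⟨x, fun hx' => ht ?_, hxJ⟩
  have hxg : x ∈ N.closure ((insert g (insert e B) : Finset α) : Set α) := by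
    by_contra hcon
    exact h ⟨x, hcon, hxJ⟩
  rw [← closure_insert_eq hx hxg, closure_insert_eq hx hx']
  exact mem_closure_insert_self hN _ t

lemma live_congr {B B' J : Finset α} (h : N.closure (B : Set α) = N.closure (B' : Set α)) :
    Live N B J ↔ Live N B' J := by
  unfold Live; rw [h]

namespace DegreeModel
variable (D : DegreeModel N c R)

/-- The reverse Cauchy–Schwarz inequality at `w` in the state `(B, J)` and degree `p + 2`. -/
def Lorentzian (w : R) (p : ℕ) (B J : Finset α) : Prop :=
  ∀ u ∈ D.V, D.ψ B J (w ^ p * (u * u)) * D.ψ B J (w ^ p * (w * w)) ≤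
    D.ψ B J (w ^ p * (w * u)) ^ 2

lemma lorentzian_of_nonpos (hN : N.E = Set.univ)
    (hc : ∀ B : Finset α, N.IsBase (B : Set α) → B.card = c) {a d : ℝ} {x : α → ℝ}
    (hx : PosCoord a d x) (p : ℕ) {B J : Finset α} (hB : N.Indep (B : Set α))
    (h : Live N B J → c ≤ p + 3 + B.card → ∀ u ∈ D.V,
      D.ψ B J (D.form a d x ^ p * (D.form a d x * u)) = 0 →
      D.ψ B J (D.form a d x ^ p * (u * u)) ≤ 0) :
    D.Lorentzian (D.form a d x) p B J := by
  intro u hu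
  have e : D.form a d x ^ p * (D.form a d x * D.form a d x) = D.form a d x ^ (p + 2) := by ring
  by_cases h0 : Live N B J ∧ c ≤ p + 3 + B.card
  · exact reverse_cauchySchwarz_of_nonpos (D.ψ B J) D.V (D.form_mem a d x)
      (by rw [e]; exact (D.ψ_pow_form hN hc hx _ hB).2 h0.1 (by omega)) (h h0.1 h0.2) hu
  · have : D.ψ B J (D.form a d x ^ (p + 2)) = 0 := by
      by_cases hL : Live N B J
      · exact D.ψ_eq_zero_of_lt hN (D.pow_mem (D.form_mem a d x) _) hB
          (by have : ¬ c ≤ p + 3 + B.card := fun h => h0 ⟨hL, h⟩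
              omega)
      · exact D.ψ_eq_zero_of_not_live hB hL (D.pow_mem (D.form_mem a d x) _)
    rw [e, this, mul_zero]
    positivity

/-- The linear forms `1`, `b_f` and `s_e`. -/
def vec (f : α) : Option (Option α) → R
  | none => 1
  | some none => D.b f
  | some (some e) => D.s e

lemma vec_mem (f : α) (i : Option (Option α)) : D.vec f i ∈ D.V := by
  rcases i with _ | _ | e
  exacts [D.one_mem, D.b_mem f, D.s_mem e]

end DegreeModel

/-- The independent set of the state obtained by multiplying with `vec f i`. -/
noncomputable def childB (B : Finset α) : Option (Option α) → Finset α
  | none => B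
  | some none => B
  | some (some e) => insert e B

/-- The second component of the state obtained by multiplying with `vec f i`. -/
noncomputable def childJ (f : α) (J : Finset α) : Option (Option α) → Finset α
  | none => J
  | some none => insert f J
  | some (some _) => J

/-- The indices `1`, `b_f` and `s_e` for `e` a representative of a parallel class. -/
def Admissible (N : Matroid α) (B : Finset α) (r : α → α) : Option (Option α) → Prop
  | none => True
  | some none => True
  | some (some e) => e ∉ N.closure (B : Set α) ∧ r e = e

lemma childB_indep (hN : N.E = Set.univ) {B : Finset α} (hB : N.Indep (B : Set α)) {r : α → α}
    {i : Option (Option α)} (hi : Admissible N B r i) : N.Indep (childB B i : Set α) := by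
  rcases i with _ | _ | e
  exacts [hB, hB, insert_indep hN hB hi.1]

/-- The coordinates of a linear form with respect to `1`, `b_f` and the representatives. -/
noncomputable def coord (N : Matroid α) (B : Finset α) (r : α → α) (f : α) (a d : ℝ) (x : α → ℝ) :
    Option (Option α) → ℝ
  | none => a + ∑ e with e ∉ N.closure (B : Set α), x e
  | some none => d + ∑ e with e ∈ N.closure (B : Set α), x e
  | some (some e) => ∑ g with g ∉ N.closure (B : Set α) ∧ r g = e,
      (x g + if g = f then d + ∑ e with e ∈ N.closure (B : Set α), x e else 0)

lemma coord_pos {B : Finset α} {r : α → α} (f : α) {a d : ℝ} {x : α → ℝ} (hx : PosCoord a d x)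
    {i : Option (Option α)} (hi : Admissible N B r i) : 0 < coord N B r f a d x i := by
  have hd : 0 < d + ∑ e with e ∈ N.closure (B : Set α), x e :=
    add_pos_of_pos_of_nonneg hx.d_pos (Finset.sum_nonneg fun e _ => (hx.x_pos e).le)
  rcases i with _ | _ | e
  · exact add_pos_of_pos_of_nonneg hx.a_pos (Finset.sum_nonneg fun e _ => (hx.x_pos e).le)
  · exact hd
  · refine Finset.sum_pos (fun g _ => add_pos_of_pos_of_nonneg (hx.x_pos g) ?_)
      ⟨e, by simpa using show e ∉ N.closure (B : Set α) ∧ r e = e from hi⟩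
    split_ifs
    exacts [hd.le, le_rfl]

namespace DegreeModel
variable (D : DegreeModel N c R)

lemma ψ_vec_mul (hN : N.E = Set.univ) {B J : Finset α} {f : α} (hfJ : f ∉ J) {r : α → α}
    {i : Option (Option α)} (hi : Admissible N B r i) (X : R) :
    D.ψ B J (D.vec f i * X) = D.ψ (childB B i) (childJ f J i) X := by
  rcases i with _ | _ | e
  · rw [vec, one_mul]; rfl
  · exact D.ψ_b B X hfJ
  · exact D.ψ_s' hN J X hi.1

lemma ψ_form_mul_eq_sum (hN : N.E = Set.univ) {B J : Finset α} {f : α}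
    (hf : f ∉ N.closure (B : Set α)) {r : α → α}
    (hr : ∀ e, N.closure ((insert (r e) B : Finset α) : Set α) =
      N.closure ((insert e B : Finset α) : Set α))
    (hrr : ∀ e, r (r e) = r e) (a d : ℝ) (x : α → ℝ) (X : R) :
    D.ψ B J (D.form a d x * X) =
      ∑ i with Admissible N B r i, coord N B r f a d x i * D.ψ B J (D.vec f i * X) := by
  have hsum : ∀ F : Option (Option α) → ℝ, ∑ i with Admissible N B r i, F i =
      F none + F (some none) + ∑ e with Admissible N B r (some (some e)), F (some (some e)) := by
    intro F
    rw [Finset.sum_filter, Fintype.sum_option, Fintype.sum_option,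
      if_pos (show Admissible N B r none from trivial),
      if_pos (show Admissible N B r (some none) from trivial), ← Finset.sum_filter, ← add_assoc]
  rw [D.ψ_form_mul_of_live hf, hsum]
  congr 1
  · rw [vec, one_mul]; rfl
  · have hmem : ∀ e, e ∉ N.closure (B : Set α) → r e ∉ N.closure (B : Set α) := by
      intro e he hre
      apply he
      have h1 := mem_closure_insert_self hN B e
      rw [← hr, Finset.coe_insert, Matroid.closure_insert_eq_of_mem_closure hre] at h1
      exact h1
    rw [← Finset.sum_fiberwise_of_maps_to (g := r)
      (t := {e : α | Admissible N B r (some (some e))})]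
    · refine Finset.sum_congr rfl fun e _ => ?_
      rw [coord, Finset.sum_mul, Finset.filter_filter]
      refine Finset.sum_congr rfl fun g hg => ?_
      have hg : g ∉ N.closure (B : Set α) ∧ r g = e := by simpa using hg
      congr 1
      rw [vec, ← hg.2]
      apply D.ψ_s_congr
      have := hr g
      rw [Finset.coe_insert, Finset.coe_insert] at this
      exact this.symm
    · intro e he
      simp only [Finset.mem_filter, Finset.mem_univ, true_and] at he ⊢
      exact ⟨hmem e he, hrr e⟩

/-- An admissible index is good in degree `q` if its state is live and of large enough rank. -/
def GoodIdx (N : Matroid α) (c : ℕ) (B J : Finset α) (r : α → α) (f : α) (q : ℕ)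
    (i : Option (Option α)) : Prop :=
  Admissible N B r i ∧ Live N (childB B i) (childJ f J i) ∧ c ≤ q + 1 + (childB B i).card

lemma ψ_form_mul_eq_sum_goodIdx (hN : N.E = Set.univ) {B J : Finset α}
    (hB : N.Indep (B : Set α)) {f : α}
    (hf : f ∉ N.closure (B : Set α)) (hfJ : f ∉ J) {r : α → α}
    (hr : ∀ e, N.closure ((insert (r e) B : Finset α) : Set α) =
      N.closure ((insert e B : Finset α) : Set α))
    (hrr : ∀ e, r (r e) = r e) (a d : ℝ) (x : α → ℝ) {q : ℕ} {X : R} (hX : X ∈ D.V ^ q) :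
    D.ψ B J (D.form a d x * X) = ∑ i : {i // GoodIdx N c B J r f q i},
      coord N B r f a d x i * D.ψ B J (D.vec f i * X) := by
  rw [D.ψ_form_mul_eq_sum hN hf hr hrr,
    ← Finset.sum_subtype (Finset.univ.filter (GoodIdx N c B J r f q)) (by simp)
      (fun i => coord N B r f a d x i * D.ψ B J (D.vec f i * X))]
  symm
  apply Finset.sum_subset
  · intro i hi
    simp only [Finset.mem_filter, Finset.mem_univ, true_and] at hi ⊢
    exact hi.1
  · intro i hi hi'
    simp only [Finset.mem_filter, Finset.mem_univ, true_and] at hi hi'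
    rw [D.ψ_vec_mul hN hfJ hi]
    by_cases hL : Live N (childB B i) (childJ f J i)
    · rw [D.ψ_eq_zero_of_lt hN hX (childB_indep hN hB hi), mul_zero]
      by_contra hcon
      exact hi' ⟨hi, hL, by omega⟩
    · rw [D.ψ_eq_zero_of_not_live (childB_indep hN hB hi) hL hX, mul_zero]

/-- The Bochner step: the inequality in degree `p + 2` implies the one in degree `p + 3`. -/
lemma lorentzian_succ (hN : N.E = Set.univ)
    (hc : ∀ B : Finset α, N.IsBase (B : Set α) → B.card = c) {a d : ℝ} {x : α → ℝ}
    (hx : PosCoord a d x) {p : ℕ}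
    (ih : ∀ {B J : Finset α}, N.Indep (B : Set α) → D.Lorentzian (D.form a d x) p B J)
    {B J : Finset α} (hB : N.Indep (B : Set α)) : D.Lorentzian (D.form a d x) (p + 1) B J := by
  refine D.lorentzian_of_nonpos hN hc hx _ hB fun hL hcard => ?_
  obtain ⟨f, hf, hfJ⟩ := id hL
  set w := D.form a d x with hw_def
  have hw : w ∈ D.V := D.form_mem a d x
  obtain ⟨r, hr, hrK⟩ := exists_representatives
    (fun e : α => N.closure ((insert e B : Finset α) : Set α))
  have hrr : ∀ e, r (r e) = r e := fun e => hrK _ _ (hr e)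
  have hnonneg : ∀ {B J : Finset α} (q : ℕ), N.Indep (B : Set α) → 0 ≤ D.ψ B J (w ^ q) :=
    fun q hB => (D.ψ_pow_form hN hc hx q hB).1
  have hpos : ∀ {B J : Finset α} {q : ℕ}, N.Indep (B : Set α) → Live N B J →
      c ≤ q + 1 + B.card → 0 < D.ψ B J (w ^ q) :=
    fun hB => (D.ψ_pow_form hN hc hx _ hB).2
  let ι := {i // GoodIdx N c B J r f (p + 2) i}
  let v : ι → R := fun i => D.vec f i
  have hv : ∀ i, v i ∈ D.V := fun i => D.vec_mem f i
  let A : ι → ι → ℝ := fun i j => D.ψ B J (w ^ (p + 1) * (v i * v j))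
  let cc : ι → ℝ := fun i => coord N B r f a d x i
  have hcc : ∀ i, 0 < cc i := fun i => coord_pos f hx i.2.1
  have hvX : ∀ (i : ι) X, D.ψ B J (v i * X) = D.ψ (childB B i) (childJ f J i) X :=
    fun i X => D.ψ_vec_mul hN hfJ i.2.1 X
  have hind : ∀ i : ι, N.Indep (childB B i : Set α) := fun i => childB_indep hN hB i.2.1
  have hrepr : ∀ (a d : ℝ) (x : α → ℝ) {X : R}, X ∈ D.V ^ (p + 2) →
      D.ψ B J (D.form a d x * X) =
        ∑ i : ι, coord N B r f a d x i * D.ψ B J (v i * X) :=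
    fun a d x X hX => D.ψ_form_mul_eq_sum_goodIdx hN hB hf hfJ hr hrr a d x hX
  let m : ι → ℝ := fun i => D.ψ (childB B i) (childJ f J i) (w ^ (p + 2)) / cc i
  have hm_pos : ∀ i, 0 < m i := fun i =>
    div_pos (hpos (hind i) i.2.2.1 i.2.2.2) (hcc i)
  have hmc : ∀ i, m i * cc i = D.ψ B J (v i * w ^ (p + 2)) := fun i => by
    rw [hvX]; exact div_mul_cancel₀ _ (hcc i).ne'
  have hA : ∀ i j, A i j = A j i := fun i j => by simp only [A, mul_comm (v i)]
  have hm : ∀ i, ∑ j, A i j * cc j = m i * cc i := by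
    intro i
    have e1 : v i * w ^ (p + 2) = w * (v i * w ^ (p + 1)) := by ring
    rw [hmc, e1, hrepr a d x (D.mul_mem_pow (hv i) (D.pow_mem hw _))]
    refine Finset.sum_congr rfl fun j _ => ?_
    rw [mul_comm]
    exact congrArg (_ * ·) (congrArg (D.ψ B J) (by ring))
  have hAu : ∀ (y : ι → ℝ) i, ∑ j, A i j * y j =
      D.ψ B J (v i * (w ^ (p + 1) * ∑ j, y j • v j)) := by
    intro y i
    simp only [Finset.mul_sum, map_sum, mul_smul_comm, map_smul, smul_eq_mul]
    refine Finset.sum_congr rfl fun j _ => ?_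
    rw [mul_comm]
    exact congrArg (_ * ·) (congrArg (D.ψ B J) (by ring))
  have huAu : ∀ (y : ι → ℝ), ∑ i, ∑ j, A i j * y i * y j =
      D.ψ B J (w ^ (p + 1) * ((∑ j, y j • v j) * ∑ j, y j • v j)) := by
    intro y
    have e1 : w ^ (p + 1) * ((∑ j, y j • v j) * ∑ j, y j • v j) =
        ∑ i, y i • (v i * (w ^ (p + 1) * ∑ j, y j • v j)) := by
      simp only [← smul_mul_assoc]
      rw [← Finset.sum_mul]
      ring
    rw [e1, map_sum]
    refine Finset.sum_congr rfl fun i _ => ?_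
    rw [map_smul, ← hAu, smul_eq_mul, Finset.mul_sum]
    exact Finset.sum_congr rfl fun j _ => by ring
  have hBoch : ∀ y : ι → ℝ, ∑ i, ∑ j, A i j * y i * y j ≤ ∑ j, (∑ i, A j i * y i) ^ 2 / m j := by
    intro y
    rw [huAu]
    set u := ∑ j, y j • v j with hu_def
    have hu : u ∈ D.V := sum_mem fun j _ => D.V.smul_mem _ (hv j)
    have e1 : w ^ (p + 1) * (u * u) = w * (w ^ p * (u * u)) := by ring
    rw [e1, hrepr a d x (by
      rw [pow_add]; exact Submodule.mul_mem_mul (D.pow_mem hw p) (D.mul_mem_two hu hu))]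
    refine Finset.sum_le_sum fun i _ => ?_
    rw [hAu, hvX, hvX, le_div_iff₀ (hm_pos i)]
    have h1 := ih (hind i) (J := childJ f J i) u hu
    have e2 : w ^ p * (w * w) = w ^ (p + 2) := by ring
    have e3 : w ^ p * (w * u) = w ^ (p + 1) * u := by ring
    rw [e2, e3] at h1
    refine le_of_eq_of_le ?_ h1
    have h2 : cc i * m i = D.ψ (childB B i) (childJ f J i) (w ^ (p + 2)) := by
      rw [mul_comm, hmc, hvX]
    rw [← h2]
    change cc i * _ * _ = _
    ring
  -- the off-diagonal entries
  have hA_none : ∀ (i j : ι), i.1 = none →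
      A i j = D.ψ (childB B j) (childJ f J j) (w ^ (p + 1)) := by
    intro i j hi
    have : v i = 1 := by simp only [v, hi]; rfl
    simp only [A, this, one_mul]
    rw [mul_comm, hvX]
  have hA_b : ∀ (i j : ι) (e : α), i.1 = some none → j.1 = some (some e) →
      A i j = D.ψ (insert e B) (insert f J) (w ^ (p + 1)) := by
    intro i j e hi hj
    have h1 := i.2.1
    have h2 := j.2.1
    have h3 := hvX i (v j * w ^ (p + 1))
    have h4 : v j = D.s e := by simp only [v, hj]; rfl
    rw [hj] at h2
    rw [h4, hi] at h3
    rw [← D.ψ_s' hN (insert f J) _ h2.1]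
    refine Eq.trans ?_ h3
    simp only [A, h4]
    congr 1
    ring
  have hnotin : ∀ (i j : ι) (e g : α), i.1 = some (some e) → j.1 = some (some g) → i ≠ j →
      g ∉ N.closure ((insert e B : Finset α) : Set α) := by
    intro i j e g hi hj hij hg
    have h1 := i.2.1
    have h2 := j.2.1
    rw [hi] at h1
    rw [hj] at h2
    apply hij
    apply Subtype.ext
    rw [hi, hj, ← h1.2, ← h2.2, hrK g e (closure_insert_eq h2.1 hg)]
  have hA_s : ∀ (i j : ι) (e g : α), i.1 = some (some e) → j.1 = some (some g) → i ≠ j →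
      A i j = D.ψ (insert g (insert e B)) J (w ^ (p + 1)) := by
    intro i j e g hi hj hij
    have h3 := hvX i (v j * w ^ (p + 1))
    have h4 : v j = D.s g := by simp only [v, hj]; rfl
    rw [h4, hi] at h3
    rw [← D.ψ_s' hN J _ (hnotin i j e g hi hj hij)]
    refine Eq.trans ?_ h3
    simp only [A, h4]
    congr 1
    ring
  have hins : ∀ (i j : ι) (e g : α), i.1 = some (some e) → j.1 = some (some g) → i ≠ j →
      N.Indep ((insert g (insert e B) : Finset α) : Set α) := by
    intro i j e g hi hj hij
    have h1 := hind i
    rw [hi] at h1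
    exact insert_indep hN h1 (hnotin i j e g hi hj hij)
  have hs_indep : ∀ (i : ι) (e : α), i.1 = some (some e) →
      N.Indep ((insert e B : Finset α) : Set α) := fun i e hi => by
    have h1 := hind i; rw [hi] at h1; exact h1
  have hs_mem : ∀ (i : ι) (e : α), i.1 = some (some e) → e ∉ N.closure (B : Set α) :=
    fun i e hi => by have h1 := i.2.1; rw [hi] at h1; exact h1.1
  have hs_live : ∀ (i : ι) (e : α), i.1 = some (some e) → Live N (insert e B) J :=
    fun i e hi => by have h1 := i.2.2.1; rw [hi] at h1; exact h1
  have hoff : ∀ i j, i ≠ j → 0 ≤ A i j := by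
    intro i j hij
    rcases hi : i.1 with _ | _ | e
    · rw [hA_none i j hi]; exact hnonneg _ (hind j)
    · rcases hj : j.1 with _ | _ | g
      · rw [hA, hA_none j i hj]; exact hnonneg _ (hind i)
      · exact absurd (Subtype.ext (hi.trans hj.symm)) hij
      · rw [hA_b i j g hi hj]; exact hnonneg _ (hs_indep j g hj)
    · rcases hj : j.1 with _ | _ | g
      · rw [hA, hA_none j i hj]; exact hnonneg _ (hind i)
      · rw [hA, hA_b j i e hj hi]; exact hnonneg _ (hs_indep i e hi)
      · rw [hA_s i j e g hi hj hij]; exact hnonneg _ (hins i j e g hi hj hij)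
  have hconn : ∀ φ : ι → ℝ, (∀ i j, 0 < A i j → φ i = φ j) → ∀ i j, φ i = φ j := by
    intro φ hφ
    by_cases h1 : c ≤ p + 3 + B.card
    · have hone : GoodIdx N c B J r f (p + 2) none := ⟨trivial, hL, h1⟩
      let i₀ : ι := ⟨none, hone⟩
      suffices h : ∀ i, φ i₀ = φ i from fun i j => (h i).symm.trans (h j)
      have hs : ∀ (i : ι) (e : α), i.1 = some (some e) → φ i₀ = φ i := by
        intro i e hi
        apply hφ
        rw [hA_none i₀ i rfl]
        refine hpos (hind i) i.2.2.1 ?_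
        rw [hi]
        change c ≤ _ + (insert e B).card
        rw [card_insert hN (hs_mem i e hi)]
        omega
      intro i
      rcases hi : i.1 with _ | _ | e
      · exact congrArg φ (Subtype.ext hi.symm)
      · have hLi := i.2.2.1
        rw [hi] at hLi
        change Live N B (insert f J) at hLi
        by_cases h2 : c ≤ p + 2 + B.card
        · apply hφ
          rw [hA_none i₀ i rfl]
          refine hpos (hind i) i.2.2.1 ?_
          rw [hi]
          exact h2
        · obtain ⟨e, he, hLe⟩ := exists_live_insert hN hc hB hLi (by omega)
          have hre : r e ∉ N.closure (B : Set α) := by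
            intro hre
            apply he
            have h1 := mem_closure_insert_self hN B e
            rw [← hr, Finset.coe_insert, Matroid.closure_insert_eq_of_mem_closure hre] at h1
            exact h1
          rw [live_congr (hr e).symm] at hLe
          let j : ι := ⟨some (some (r e)), ⟨hre, hrr e⟩,
            hLe.imp fun _ h => ⟨h.1, fun h' => h.2 (Finset.mem_insert_of_mem h')⟩, by
              change c ≤ _ + (insert (r e) B).card
              rw [card_insert hN hre]; omega⟩
          rw [hs j (r e) rfl]
          symm
          apply hφ
          rw [hA_b i j (r e) hi rfl]
          exact hpos (hs_indep j _ rfl) hLe (by rw [card_insert hN hre]; omega)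
      · exact hs i e hi
    · have hss : ∀ (i : ι), ∃ e, i.1 = some (some e) := by
        intro i
        have h3 := i.2.2.2
        rcases hi : i.1 with _ | _ | e
        · rw [hi] at h3; exact absurd h3 h1
        · rw [hi] at h3; exact absurd h3 h1
        · exact ⟨e, rfl⟩
      have hedge : ∀ (i j : ι) (e g : α), i.1 = some (some e) → j.1 = some (some g) → i ≠ j →
          Live N (insert g (insert e B)) J → φ i = φ j := by
        intro i j e g hi hj hij hLij
        apply hφ
        rw [hA_s i j e g hi hj hij]
        refine hpos (hins i j e g hi hj hij) hLij ?_
        rw [card_insert hN (hnotin i j e g hi hj hij), card_insert hN (hs_mem i e hi)]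
        omega
      intro i j
      obtain ⟨e, hi⟩ := hss i
      obtain ⟨g, hj⟩ := hss j
      by_cases hij : i = j
      · rw [hij]
      by_cases hLij : Live N (insert g (insert e B)) J
      · exact hedge i j e g hi hj hij hLij
      obtain ⟨t₀, ht₀⟩ := exists_notMem_closure hN hc (hins i j e g hi hj hij) (by
        rw [card_insert hN (hnotin i j e g hi hj hij), card_insert hN (hs_mem i e hi)]
        omega)
      have hBsub : ∀ {t}, t ∉ N.closure ((insert g (insert e B) : Finset α) : Set α) →
          t ∉ N.closure (B : Set α) := fun ht ht' =>
        ht (subset_closure_insert _ _ (subset_closure_insert _ _ ht'))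
      have ht : r t₀ ∉ N.closure ((insert g (insert e B) : Finset α) : Set α) := by
        intro h
        apply ht₀
        have h1 := mem_closure_insert_self hN B t₀
        rw [← hr t₀] at h1
        refine N.closure_subset_closure_of_subset_closure ?_ h1
        intro y hy
        rcases Finset.mem_insert.1 (Finset.mem_coe.1 hy) with rfl | hy
        · exact h
        · exact N.mem_closure_of_mem (by simp [hy]) (by simp [hN])
      set t := r t₀ with ht_def
      have ht' : t ∉ N.closure ((insert e (insert g B) : Finset α) : Set α) := by
        rwa [Finset.insert_comm]
      have hLe := live_insert_insert (hs_live i e hi) hLij ht hN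
      have hLg := live_insert_insert (hs_live j g hj) (by rwa [Finset.insert_comm]) ht' hN
      let k : ι := ⟨some (some t), ⟨hBsub ht, hrr t₀⟩,
        live_of_live_insert (e := e) (by
          change Live N (insert e (insert t B)) J
          rw [Finset.insert_comm]; exact hLe), by
          change c ≤ _ + (insert t B).card
          rw [card_insert hN (hBsub ht)]; omega⟩
      have hik : i ≠ k := by
        intro h
        rw [h] at hi
        have : t = e := by simpa [k] using hi
        rw [this] at ht'
        exact ht' (mem_closure_insert_self hN _ e)
      have hjk : j ≠ k := by
        intro h
        rw [h] at hj
        have : t = g := by simpa [k] using hj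
        rw [this] at ht
        exact ht (mem_closure_insert_self hN _ g)
      rw [hedge i k e t hi rfl hik hLe, hedge j k g t hj rfl hjk hLg]
  intro u hu h0
  obtain ⟨a', d', x', rfl⟩ := D.exists_form hu
  set u := D.form a' d' x' with hu_def
  let y : ι → ℝ := fun i => coord N B r f a' d' x' i
  have hfin := bochner_nonpos hA hcc hm_pos hm hoff hconn hBoch y ?_
  · refine le_of_eq_of_le ?_ hfin
    have e1 : w ^ (p + 1) * (u * u) = u * (w ^ (p + 1) * u) := by ring
    rw [e1, hrepr a' d' x' (by
      rw [mul_comm]; exact D.mul_mem_pow hu (D.pow_mem hw _))]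
    refine Finset.sum_congr rfl fun i _ => ?_
    have e2 : v i * (w ^ (p + 1) * u) = u * (w ^ (p + 1) * v i) := by ring
    rw [e2, hrepr a' d' x' (by
      rw [mul_comm]; exact D.mul_mem_pow (hv i) (D.pow_mem hw _)), Finset.mul_sum]
    refine Finset.sum_congr rfl fun j _ => ?_
    have e3 : v j * (w ^ (p + 1) * v i) = w ^ (p + 1) * (v i * v j) := by ring
    rw [e3]
    change y i * (y j * A i j) = _
    ring
  · have e1 : w ^ (p + 1) * (w * u) = u * w ^ (p + 2) := by ring
    rw [e1, hrepr a' d' x' (D.pow_mem hw _)] at h0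
    rw [← h0]
    refine Finset.sum_congr rfl fun i _ => ?_
    rw [hmc, mul_comm]

end DegreeModel
end Step

section Base
open scoped Classical
set_option linter.unusedSectionVars false

/-- Aczél's inequality in orthogonal form. -/
lemma sq_sub_sum_sq_nonpos {κ : Type*} (s : Finset κ) {P p : ℝ} {S t : κ → ℝ}
    (h : 0 < P * P - ∑ k ∈ s, S k * S k) (h0 : P * p - ∑ k ∈ s, S k * t k = 0) :
    p * p - ∑ k ∈ s, t k * t k ≤ 0 := by
  have hcs := Finset.sum_mul_sq_le_sq_mul_sq s S t
  simp only [pow_two] at hcs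
  rw [← sub_eq_zero.1 h0] at hcs
  have hS : 0 ≤ ∑ k ∈ s, S k * S k := Finset.sum_nonneg fun k _ => mul_self_nonneg _
  have ht : 0 ≤ ∑ k ∈ s, t k * t k := Finset.sum_nonneg fun k _ => mul_self_nonneg _
  have hP : 0 < P * P := by linarith
  by_contra! hcon
  nlinarith [mul_le_mul_of_nonneg_right (sub_nonneg.1 h.le) ht]

lemma sum_sum_ite_key {α κ : Type*} [DecidableEq κ] (G : Finset α) (K : α → κ) (z y : α → ℝ) :
    ∑ e ∈ G, ∑ g ∈ G, (if K e = K g then z e * y g else 0) =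
      ∑ k ∈ G.image K, (∑ e ∈ G with K e = k, z e) * ∑ e ∈ G with K e = k, y e := by
  rw [← Finset.sum_fiberwise_of_maps_to (g := K) (t := G.image K)
    (fun e he => Finset.mem_image_of_mem K he)]
  refine Finset.sum_congr rfl fun k _ => ?_
  rw [Finset.sum_mul]
  refine Finset.sum_congr rfl fun e he => ?_
  rw [← Finset.sum_filter, Finset.mul_sum]
  refine Finset.sum_congr ?_ fun _ _ => rfl
  ext g
  simp only [Finset.mem_filter] at he ⊢
  rw [he.2, eq_comm]

/-- The signature criterion for a quadratic form with isotropic vector `1`. -/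
lemma nonpos_of_isotropic {R : Type*} [CommRing R] [Algebra ℝ R] (L : R →ₗ[ℝ] ℝ)
    (W : Submodule ℝ R) {w : R} (hw : w ∈ W) (hLw : 0 < L w)
    (hww : 0 ≤ L (w * w)) (h : ∀ u ∈ W, L u = 0 → L (u * u) ≤ 0) {u : R} (hu : u ∈ W)
    (hwu : L (w * u) = 0) : L (u * u) ≤ 0 := by
  set t := L u / L w with ht
  have e2 : (u - t • w) * (u - t • w) = u * u - (2 * t) • (w * u) + (t ^ 2) • (w * w) := by
    simp only [Algebra.smul_def, map_mul, map_pow, map_ofNat]; ring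
  have h2 := h (u - t • w) (sub_mem hu (W.smul_mem t hw)) (by
    rw [map_sub, map_smul, smul_eq_mul, ht, div_mul_cancel₀ _ hLw.ne', sub_self])
  rw [e2, map_add, map_sub, map_smul, map_smul, smul_eq_mul, smul_eq_mul, hwu] at h2
  nlinarith [mul_nonneg (sq_nonneg t) hww]

variable {α : Type*} [Fintype α] {N : Matroid α} {c : ℕ} {R : Type*} [CommRing R] [Algebra ℝ R]

lemma not_live_of_card (hN : N.E = Set.univ)
    (hc : ∀ B : Finset α, N.IsBase (B : Set α) → B.card = c) {B J : Finset α}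
    (hB : N.Indep (B : Set α)) (h : B.card = c) : ¬ Live N B J := by
  rintro ⟨e, he, -⟩
  have := card_lt_of_notMem_closure hN hc hB he
  omega

namespace DegreeModel
variable (D : DegreeModel N c R)

lemma exists_coord {B J : Finset α} {f : α} (hf : f ∉ N.closure (B : Set α)) {u : R}
    (hu : u ∈ D.V) : ∃ (a d : ℝ) (z : α → ℝ), ∀ X, D.ψ B J (u * X) =
      a * D.ψ B J X + d * D.ψ B J (D.b f * X) +
        ∑ e with e ∉ N.closure (B : Set α), z e * D.ψ B J (D.s e * X) := by
  obtain ⟨a, d, x, rfl⟩ := D.exists_form hu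
  exact ⟨_, _, _, fun X => D.ψ_form_mul_of_live hf a d x X⟩

lemma ψ_one_eq_ite {B J : Finset α} (hB : N.Indep (B : Set α)) (h : B.card + 1 = c) :
    D.ψ B J 1 = if Live N B J then 1 else 0 := by
  split_ifs with hL
  · exact D.ψ_one_of_live hB hL h
  · exact D.ψ_eq_zero_of_not_live hB hL D.one_mem_pow

lemma nonpos_of_card_add_one (hN : N.E = Set.univ)
    (hc : ∀ B : Finset α, N.IsBase (B : Set α) → B.card = c) {a d : ℝ} {x : α → ℝ}
    (hx : PosCoord a d x) {B J : Finset α} (hB : N.Indep (B : Set α)) (hL : Live N B J)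
    (hBc : B.card + 1 = c) {u : R} (hu : u ∈ D.V) (h0 : D.ψ B J (D.form a d x * u) = 0) :
    D.ψ B J (u * u) ≤ 0 := by
  obtain ⟨f, hf, hfJ⟩ := id hL
  have hs : ∀ e, e ∉ N.closure (B : Set α) → ∀ {q : ℕ} {J} {X}, X ∈ D.V ^ q →
      D.ψ B J (D.s e * X) = 0 := by
    intro e he q J X hX
    rw [D.ψ_s' hN J X he]
    have hi := insert_indep hN hB he
    exact D.ψ_eq_zero_of_not_live hi
      (not_live_of_card hN hc hi (by rw [card_insert hN he, hBc])) hX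
  have hsum : ∀ (z : α → ℝ) {q : ℕ} {X}, X ∈ D.V ^ q →
      ∑ e with e ∉ N.closure (B : Set α), z e * D.ψ B J (D.s e * X) = 0 := by
    intro z q X hX
    refine Finset.sum_eq_zero fun e he => ?_
    rw [hs e (by simpa using he) hX, mul_zero]
  have h1 : D.ψ B J 1 = 1 := D.ψ_one_of_live hB hL hBc
  have hbX : ∀ X, D.ψ B J (D.b f * X) = D.ψ B (insert f J) X := fun X => D.ψ_b B X hfJ
  have hcase : (D.ψ B J (D.b f) = 0 ∧ D.ψ B J (D.b f * D.b f) = 0) ∨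
      (D.ψ B J (D.b f) = 1 ∧ 0 ≤ D.ψ B J (D.b f * D.b f) ∧ D.ψ B J (D.b f * D.b f) ≤ 1) := by
    have hb1 := hbX 1
    rw [mul_one, D.ψ_one_eq_ite hB hBc] at hb1
    rw [hb1, hbX]
    by_cases hL' : Live N B (insert f J)
    · right
      rw [if_pos hL']
      obtain ⟨g, hg, hgJ⟩ := hL'
      have h2 := D.ψ_δ hN 1 hg hgJ
      rw [mul_one, D.ψ_one_eq_ite hB hBc, D.ψ_eq_zero_of_not_live (insert_indep hN hB hg)
        (not_live_of_card hN hc (insert_indep hN hB hg) (by rw [card_insert hN hg, hBc]))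
        D.one_mem_pow] at h2
      have h3 := hs f hf (J := insert f J) D.one_mem_pow
      rw [mul_one] at h3
      rw [D.b_eq, map_sub, h3, h2]
      refine ⟨rfl, ?_, ?_⟩ <;> split_ifs <;> norm_num
    · left
      rw [if_neg hL']
      have : D.b f ∈ D.V ^ 1 := by rw [pow_one]; exact D.b_mem f
      exact ⟨rfl, D.ψ_eq_zero_of_not_live hB hL' this⟩
  have hV1 : ∀ {v}, v ∈ D.V → v ∈ D.V ^ 1 := fun hv => by rwa [pow_one]
  obtain ⟨a', d', z, hz⟩ := D.exists_coord (J := J) hf hu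
  have hu1 := hz 1
  rw [hsum z D.one_mem_pow, mul_one, mul_one, h1] at hu1
  have hub := hz (D.b f)
  rw [hsum z (hV1 (D.b_mem f))] at hub
  have huu := hz u
  rw [hsum z (hV1 hu), mul_comm (D.b f), hub, hu1] at huu
  rw [D.ψ_form_mul_of_live hf, hsum _ (hV1 hu), mul_comm (D.b f), hub, hu1] at h0
  have hA : 0 < a + ∑ e with e ∉ N.closure (B : Set α), x e :=
    add_pos_of_pos_of_nonneg hx.a_pos (Finset.sum_nonneg fun e _ => (hx.x_pos e).le)
  have hD : 0 < d + ∑ e with e ∈ N.closure (B : Set α), x e :=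
    add_pos_of_pos_of_nonneg hx.d_pos (Finset.sum_nonneg fun e _ => (hx.x_pos e).le)
  set A := a + ∑ e with e ∉ N.closure (B : Set α), x e
  set E := d + ∑ e with e ∈ N.closure (B : Set α), x e
  rw [huu]
  rcases hcase with ⟨hb, hbb⟩ | ⟨hb, hbb0, hbb1⟩
  · rw [hb, hbb] at h0 ⊢
    have : a' = 0 := by
      have : A * a' = 0 := by linarith
      exact (mul_eq_zero.1 this).resolve_left hA.ne'
    rw [this]; simp
  · rw [hb] at h0 ⊢
    set τ := D.ψ B J (D.b f * D.b f)
    have h2 : (A + E) * (a' + d') = (1 - τ) * E * d' := by linear_combination h0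
    have h3 : (A + E) ^ 2 * (a' + d') ^ 2 = ((1 - τ) * E * d') ^ 2 := by rw [← h2]; ring
    have h4 : (1 - τ) * E ^ 2 ≤ (A + E) ^ 2 := by
      nlinarith [mul_pos hA hD, sq_nonneg A, sq_nonneg E]
    have h5 : (A + E) ^ 2 * (a' + d') ^ 2 ≤ (A + E) ^ 2 * ((1 - τ) * d' ^ 2) := by
      rw [h3]
      have : 0 ≤ (1 - τ) * d' ^ 2 := mul_nonneg (by linarith) (sq_nonneg _)
      nlinarith [mul_le_mul_of_nonneg_right h4 this]
    have h6 := le_of_mul_le_mul_left h5 (by positivity)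
    nlinarith

end DegreeModel

/-- Some element outside the closure of `B` is the only one not in `J`. -/
def LiveSingleton (N : Matroid α) (B J : Finset α) : Prop :=
  ∃ h, h ∉ N.closure (B : Set α) ∧ h ∉ J ∧ ¬ Live N B (insert h J)

lemma liveSingleton_congr {B B' J : Finset α}
    (h : N.closure (B : Set α) = N.closure (B' : Set α)) :
    LiveSingleton N B J ↔ LiveSingleton N B' J := by
  simp only [LiveSingleton, h, live_congr h]

lemma Live.mono {B J J' : Finset α} (h : Live N B J) (hJ : J' ⊆ J) : Live N B J' :=
  h.imp fun _ he => ⟨he.1, fun h => he.2 (hJ h)⟩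

namespace DegreeModel
variable (D : DegreeModel N c R)

lemma ψ_one_eq_zero {B J : Finset α} (hB : N.Indep (B : Set α)) (h : B.card + 1 ≠ c) :
    D.ψ B J 1 = 0 := by
  by_cases hL : Live N B J
  · rw [D.ψ_one hB hL, if_neg h]
  · exact D.ψ_eq_zero_of_not_live hB hL D.one_mem_pow

lemma ψ_s_mul_s_of_card_add_two (hN : N.E = Set.univ) {B J : Finset α}
    (hB : N.Indep (B : Set α)) (hBc : B.card + 2 = c) {e g : α}
    (he : e ∉ N.closure (B : Set α)) (hg : g ∉ N.closure (B : Set α)) :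
    D.ψ B J (D.s e * D.s g) =
      -(if N.closure ((insert e B : Finset α) : Set α) =
          N.closure ((insert g B : Finset α) : Set α) ∧
        LiveSingleton N (insert e B) J then 1 else 0) := by
  have hi := insert_indep hN hB he
  have hci : (insert e B).card + 1 = c := by rw [card_insert hN he]; omega
  rw [D.ψ_s' hN J _ he, ← mul_one (D.s g)]
  by_cases hge : g ∈ N.closure ((insert e B : Finset α) : Set α)
  · rw [D.ψ_s_of_mem_closure J 1 hge, D.ψ_one_eq_ite hi hci]
    simp only [(closure_insert_eq hg hge).symm, true_and]
    have hlive : ∀ h, h ∉ N.closure ((insert e B : Finset α) : Set α) → h ∉ J →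
        D.ψ (insert e B) J (D.δ * 1) = if Live N (insert e B) (insert h J) then 1 else 0 := by
      intro h hh hhJ
      have hi' := insert_indep hN hi hh
      rw [D.ψ_δ hN 1 hh hhJ, D.ψ_one_eq_ite hi hci, D.ψ_one_eq_zero hi'
        (by rw [card_insert hN hh]; omega), add_zero]
    by_cases hs : LiveSingleton N (insert e B) J
    · obtain ⟨h, hh, hhJ, hhL⟩ := id hs
      rw [hlive h hh hhJ, if_neg hhL, if_pos ⟨h, hh, hhJ⟩, if_pos hs]
      norm_num
    · rw [if_neg hs]
      by_cases hL : Live N (insert e B) J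
      · obtain ⟨h, hh, hhJ⟩ := id hL
        rw [hlive h hh hhJ, if_pos hL, if_pos (by
          by_contra hcon
          exact hs ⟨h, hh, hhJ, hcon⟩)]
        norm_num
      · rw [if_neg hL, D.ψ_eq_zero_of_not_live hi hL
          (D.mul_mem_pow D.δ_mem D.one_mem_pow)]
        norm_num
  · have hK : N.closure ((insert e B : Finset α) : Set α) ≠
        N.closure ((insert g B : Finset α) : Set α) := by
      intro h
      rw [h] at hge
      exact hge (mem_closure_insert_self hN B g)
    rw [if_neg (fun h => hK h.1), D.ψ_s' hN J _ hge, D.ψ_one_eq_zero (insert_indep hN hi hge)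
      (by rw [card_insert hN hge]; omega), neg_zero]

lemma nonpos_of_card_add_two (hN : N.E = Set.univ) {B J : Finset α}
    (hB : N.Indep (B : Set α)) (hL : Live N B J)
    (hBc : B.card + 2 = c) {u : R} (hu : u ∈ D.V) (h0 : D.ψ B J u = 0) :
    D.ψ B J (u * u) ≤ 0 := by
  obtain ⟨f, hf, hfJ⟩ := id hL
  obtain ⟨a, d, z, hz⟩ := D.exists_coord (J := J) hf hu
  set G : Finset α := {e | e ∉ N.closure (B : Set α)} with hG
  have hGm : ∀ {e}, e ∈ G → e ∉ N.closure (B : Set α) := fun he => by simpa [hG] using he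
  have hmG : ∀ {e}, e ∉ N.closure (B : Set α) → e ∈ G := fun he => by simpa [hG] using he
  have hins : ∀ {e}, e ∈ G → (insert e B).card + 1 = c := fun he => by
    rw [card_insert hN (hGm he)]; omega
  let K : α → Set α := fun e => N.closure ((insert e B : Finset α) : Set α)
  let t : α → ℝ := fun e => if Live N (insert e B) J then 1 else 0
  let l : α → ℝ := fun e => if Live N (insert e B) (insert f J) then 1 else 0
  let y : α → ℝ := fun e => if LiveSingleton N (insert e B) J then z e else 0
  have hs : ∀ {e}, e ∈ G → ∀ J', D.ψ B J' (D.s e) =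
      if Live N (insert e B) J' then 1 else 0 := by
    intro e he J'
    rw [← mul_one (D.s e), D.ψ_s' hN J' _ (hGm he),
      D.ψ_one_eq_ite (insert_indep hN hB (hGm he)) (hins he)]
  have h1 : ∀ J', D.ψ B J' 1 = 0 := fun J' => D.ψ_one_eq_zero hB (by omega)
  have hb1 : D.ψ B J (D.b f) = 0 := by rw [← mul_one (D.b f), D.ψ_b B 1 hfJ, h1]
  have hsb : ∀ {e}, e ∈ G → D.ψ B J (D.s e * D.b f) = l e := by
    intro e he
    rw [mul_comm, D.ψ_b B _ hfJ, hs he]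
  set β := D.ψ B J (D.b f * D.b f) with hβ
  have hzt : ∑ e ∈ G, z e * t e = 0 := by
    have := hz 1
    simp only [mul_one, h1, hb1, h0, mul_zero, zero_add] at this
    rw [this]
    exact Finset.sum_congr rfl fun e he => by rw [hs he]
  have hbu : D.ψ B J (D.b f * u) = d * β + ∑ e ∈ G, z e * l e := by
    rw [mul_comm, hz, hb1, mul_zero, zero_add, hβ]
    congr 1
    exact Finset.sum_congr rfl fun e he => by rw [hsb he]
  have hsu : ∀ e ∈ G, D.ψ B J (D.s e * u) = a * t e + d * l e -
      ∑ g ∈ G, (if K e = K g ∧ LiveSingleton N (insert e B) J then z g else 0) := by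
    intro e he
    rw [mul_comm, hz, hs he, mul_comm (D.b f), hsb he, sub_eq_add_neg, ← Finset.sum_neg_distrib]
    congr 1
    refine Finset.sum_congr rfl fun g hg => ?_
    rw [mul_comm (D.s g), D.ψ_s_mul_s_of_card_add_two hN hB hBc (hGm he) (hGm hg), mul_neg,
      mul_ite, mul_one, mul_zero]
  have hkey : ∑ e ∈ G, z e * ∑ g ∈ G,
      (if K e = K g ∧ LiveSingleton N (insert e B) J then z g else 0) =
      ∑ k ∈ G.image K, (∑ e ∈ G with K e = k, y e) * ∑ e ∈ G with K e = k, y e := by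
    rw [← sum_sum_ite_key]
    refine Finset.sum_congr rfl fun e _ => ?_
    rw [Finset.mul_sum]
    refine Finset.sum_congr rfl fun g _ => ?_
    by_cases hK : K e = K g
    · simp only [hK, true_and, y, if_true, liveSingleton_congr (J := J) hK]
      split_ifs <;> simp
    · simp [hK]
  have huu : D.ψ B J (u * u) = d * d * β + 2 * d * ∑ e ∈ G, z e * l e -
      ∑ k ∈ G.image K, (∑ e ∈ G with K e = k, y e) * ∑ e ∈ G with K e = k, y e := by
    have e0 : ∑ e ∈ G, z e * D.ψ B J (D.s e * u) = ∑ e ∈ G, z e * (a * t e + d * l e -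
        ∑ g ∈ G, (if K e = K g ∧ LiveSingleton N (insert e B) J then z g else 0)) :=
      Finset.sum_congr rfl fun e he => by rw [hsu e he]
    rw [hz, h0, hbu, e0, ← hkey]
    simp only [mul_sub, mul_add, Finset.sum_add_distrib, Finset.sum_sub_distrib]
    have e1 : ∑ e ∈ G, z e * (a * t e) = a * ∑ e ∈ G, z e * t e := by
      rw [Finset.mul_sum]; exact Finset.sum_congr rfl fun e _ => by ring
    have e2 : ∑ e ∈ G, z e * (d * l e) = d * ∑ e ∈ G, z e * l e := by
      rw [Finset.mul_sum]; exact Finset.sum_congr rfl fun e _ => by ring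
    rw [e1, e2, hzt]; ring
  have hSS : 0 ≤ ∑ k ∈ G.image K, (∑ e ∈ G with K e = k, y e) * ∑ e ∈ G with K e = k, y e :=
    Finset.sum_nonneg fun k _ => mul_self_nonneg _
  rw [huu]
  by_cases hLf : Live N B (insert f J)
  swap
  · have hβ0 : β = 0 := by
      rw [hβ, D.ψ_b B _ hfJ]
      exact D.ψ_eq_zero_of_not_live hB hLf (q := 1) (by rw [pow_one]; exact D.b_mem f)
    have hl0 : ∀ e, l e = 0 := fun e => if_neg fun h => hLf (live_of_live_insert h)
    simp only [hβ0, hl0, mul_zero, Finset.sum_const_zero]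
    linarith
  obtain ⟨g, hg, hgJ⟩ := hLf
  have hfg : g ≠ f := fun h => hgJ (by simp [h])
  have hgJ' : g ∉ J := fun h => hgJ (by simp [h])
  have hβlg : β = l g - l f := by
    rw [hβ, D.ψ_b B _ hfJ, D.b_eq, map_sub, hs (hmG hf), ← mul_one D.δ, D.ψ_δ hN 1 hg hgJ, h1,
      zero_add, D.ψ_one_eq_ite (insert_indep hN hB hg) (hins (hmG hg))]
  have hlf : l f = t f := by
    have : Live N (insert f B) (insert f J) ↔ Live N (insert f B) J := by
      refine ⟨fun h => h.mono (by simp), ?_⟩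
      rintro ⟨h, hh, hhJ⟩
      refine ⟨h, hh, ?_⟩
      simp only [Finset.mem_insert, not_or]
      exact ⟨fun h' => hh (h' ▸ mem_closure_insert_self hN B f), hhJ⟩
    simp only [l, t, this]
  by_cases hcase : ∃ e₀, e₀ ∈ G ∧ f ∉ K e₀ ∧ ¬ Live N (insert e₀ B) (insert f J)
  · obtain ⟨e₀, he₀, hfe, hnl⟩ := hcase
    have hge₀ : g ∈ K e₀ := by
      by_contra hcon
      exact hnl ⟨g, hcon, hgJ⟩
    have hKg : K g = K e₀ := closure_insert_eq hg hge₀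
    have htl : ∀ e ∈ G, z e * t e = z e * l e + if K e = K e₀ then z e else 0 := by
      intro e he
      by_cases hK : K e = K e₀
      · have h1 : Live N (insert e B) J :=
          ⟨f, by rw [show N.closure _ = K e₀ from hK]; exact hfe, hfJ⟩
        have h2 : ¬ Live N (insert e B) (insert f J) := by rwa [live_congr hK]
        simp [t, l, h1, h2, hK]
      · have : Live N (insert e B) J ↔ Live N (insert e B) (insert f J) := by
          refine ⟨?_, fun h => h.mono (by simp)⟩
          intro _
          refine ⟨g, fun h => hK ?_, hgJ⟩
          rw [← hKg]
          exact (closure_insert_eq hg h).symm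
        simp [t, l, this, hK]
    have hl_g : l g = 0 := by
      have : ¬ Live N (insert g B) (insert f J) := by rwa [live_congr hKg]
      simp [l, this]
    have hl_f : l f = 1 := by
      rw [hlf]
      refine if_pos ⟨g, fun h => hfe ?_, hgJ'⟩
      rw [← hKg, show K g = K f from closure_insert_eq hg h]
      exact mem_closure_insert_self hN B f
    have hzl : ∑ e ∈ G, z e * l e = -∑ e ∈ G with K e = K e₀, y e := by
      have h2 := hzt
      rw [Finset.sum_congr rfl htl, Finset.sum_add_distrib, ← Finset.sum_filter] at h2
      rw [eq_neg_iff_add_eq_zero, ← h2]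
      congr 1
      refine Finset.sum_congr rfl fun e he => ?_
      have hK : K e = K e₀ := (Finset.mem_filter.1 he).2
      refine if_pos ((liveSingleton_congr hK).2 ⟨f, hfe, hfJ, hnl⟩)
    have hone := Finset.single_le_sum (f := fun k => (∑ e ∈ G with K e = k, y e) *
      ∑ e ∈ G with K e = k, y e) (fun k _ => mul_self_nonneg _) (Finset.mem_image_of_mem K he₀)
    rw [hβlg, hl_g, hl_f, hzl]
    nlinarith [sq_nonneg (d + ∑ e ∈ G with K e = K e₀, y e)]
  · push Not at hcase
    have htl : ∀ e ∈ G, t e = l e := by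
      intro e he
      have : Live N (insert e B) J ↔ Live N (insert e B) (insert f J) := by
        refine ⟨?_, fun h => h.mono (by simp)⟩
        rintro ⟨h, hh, hhJ⟩
        by_cases hhf : h = f
        · exact hcase e he (hhf ▸ hh)
        · exact ⟨h, hh, by simp [hhf, hhJ]⟩
      simp [t, l, this]
    have hzl : ∑ e ∈ G, z e * l e = 0 := by
      rw [← hzt]; exact Finset.sum_congr rfl fun e he => by rw [htl e he]
    have hβ0 : β ≤ 0 := by
      rw [hβlg]
      by_cases hlf' : Live N (insert f B) (insert f J)
      · simp only [l, hlf', if_true]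
        split_ifs <;> norm_num
      · have : g ∈ K f := by
          by_contra hcon
          exact hlf' ⟨g, hcon, hgJ⟩
        simp [l, live_congr (closure_insert_eq hg this)]
    rw [hzl]
    nlinarith [mul_nonneg (mul_self_nonneg d) (neg_nonneg.2 hβ0)]

end DegreeModel

/-- After contracting `B`, the elements not in `J` span a line. -/
def LiveParallel (N : Matroid α) (B J : Finset α) : Prop :=
  ∃ h, h ∉ N.closure (B : Set α) ∧ h ∉ J ∧ ¬ Live N (insert h B) J

/-- The flat spanned by `B` and the elements not in `J`. -/
def liveSpan (N : Matroid α) (B J : Finset α) : Set α :=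
  N.closure ((B : Set α) ∪ {x | x ∉ J})

lemma LiveParallel.live {B J : Finset α} (h : LiveParallel N B J) : Live N B J :=
  h.imp fun _ hh => ⟨hh.1, hh.2.1⟩

lemma closure_insert_congr_of_closure_eq {B B' : Finset α}
    (h : N.closure (B : Set α) = N.closure (B' : Set α)) (e : α) :
    N.closure ((insert e B : Finset α) : Set α) = N.closure ((insert e B' : Finset α) : Set α) := by
  rw [Finset.coe_insert, Finset.coe_insert, ← N.closure_insert_closure_eq_closure_insert, h,
    N.closure_insert_closure_eq_closure_insert]

lemma liveParallel_congr {B B' J : Finset α}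
    (h : N.closure (B : Set α) = N.closure (B' : Set α)) :
    LiveParallel N B J ↔ LiveParallel N B' J := by
  simp only [LiveParallel, h, live_congr (closure_insert_congr_of_closure_eq h _)]

lemma liveSpan_congr {B B' : Finset α} (J : Finset α)
    (h : N.closure (B : Set α) = N.closure (B' : Set α)) : liveSpan N B J = liveSpan N B' J := by
  rw [liveSpan, ← N.closure_union_closure_left_eq, h, N.closure_union_closure_left_eq, liveSpan]

lemma liveSpan_eq_of_not_live (hN : N.E = Set.univ) {B J : Finset α} {h : α} (hJ : h ∉ J)
    (hL : ¬ Live N (insert h B) J) :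
    liveSpan N B J = N.closure ((insert h B : Finset α) : Set α) := by
  apply Set.Subset.antisymm
  · apply N.closure_subset_closure_of_subset_closure
    rintro x (hx | hx)
    · exact N.mem_closure_of_mem (by simpa using Or.inr hx) (by simp [hN])
    · by_contra hcon
      exact hL ⟨x, hcon, hx⟩
  · apply N.closure_subset_closure
    rw [Finset.coe_insert, Set.insert_subset_iff]
    exact ⟨Or.inr hJ, Set.subset_union_left⟩

lemma mem_liveSpan (hN : N.E = Set.univ) {B J : Finset α} {e : α} (he : e ∈ B) :
    e ∈ liveSpan N B J :=
  N.mem_closure_of_mem (Or.inl he) (by simp [hN])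

lemma not_live_insert (hN : N.E = Set.univ) {B J : Finset α} {g : α}
    (hP : LiveParallel N B J) (hg : g ∉ N.closure (B : Set α)) (hgs : g ∈ liveSpan N B J) :
    ¬ Live N (insert g B) J := by
  obtain ⟨h, -, hhJ, hhL⟩ := hP
  rw [liveSpan_eq_of_not_live hN hhJ hhL] at hgs
  rwa [live_congr (closure_insert_eq hg hgs)]

lemma liveParallel_of_not_live (hN : N.E = Set.univ) {B J : Finset α} {g : α}
    (hB : Live N B J) (hL : ¬ Live N (insert g B) J) :
    LiveParallel N B J ∧ liveSpan N B J = N.closure ((insert g B : Finset α) : Set α) := by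
  obtain ⟨h, hh, hhJ⟩ := hB
  have hcl : N.closure ((insert h B : Finset α) : Set α) =
      N.closure ((insert g B : Finset α) : Set α) := by
    refine closure_insert_eq hh ?_
    by_contra hcon
    exact hL ⟨h, hcon, hhJ⟩
  have hL' : ¬ Live N (insert h B) J := by rwa [live_congr hcl]
  exact ⟨⟨h, hh, hhJ, hL'⟩, by rw [liveSpan_eq_of_not_live hN hhJ hL', hcl]⟩

namespace DegreeModel
variable (D : DegreeModel N c R)

lemma ψ_s_mul_s_of_card_add_three (hN : N.E = Set.univ) {B J : Finset α}
    (hB : N.Indep (B : Set α)) (hBc : B.card + 3 = c) {e g : α}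
    (he : e ∉ N.closure (B : Set α)) (hg : g ∉ N.closure (B : Set α)) :
    D.ψ B J (D.s e * D.s g) =
      (if Live N (insert e B) J then 1 else 0) * (if Live N (insert g B) J then 1 else 0) -
      if liveSpan N (insert e B) J = liveSpan N (insert g B) J then
        (if LiveParallel N (insert e B) J then 1 else 0) *
        (if LiveParallel N (insert g B) J then 1 else 0) else 0 := by
  have hi := insert_indep hN hB he
  have hci : (insert e B).card + 2 = c := by rw [card_insert hN he]; omega
  have hdead : ∀ {e g : α}, e ∉ N.closure (B : Set α) → ¬ Live N (insert e B) J →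
      D.ψ B J (D.s e * D.s g) = 0 := by
    intro e g he hL
    rw [D.ψ_s' hN J _ he]
    exact D.ψ_eq_zero_of_not_live (insert_indep hN hB he) hL (q := 1)
      (by rw [pow_one]; exact D.s_mem g)
  by_cases hLe : Live N (insert e B) J
  swap
  · rw [hdead he hLe, if_neg hLe, if_neg (c := LiveParallel N (insert e B) J)
      fun h => hLe h.live]
    simp
  by_cases hLg : Live N (insert g B) J
  swap
  · rw [mul_comm (D.s e), hdead hg hLg, if_neg hLg, if_neg (c := LiveParallel N (insert g B) J)
      fun h => hLg h.live]
    simp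
  rw [if_pos hLe, if_pos hLg, D.ψ_s' hN J _ he, ← mul_one (D.s g)]
  by_cases hge : g ∈ N.closure ((insert e B : Finset α) : Set α)
  · have hK := closure_insert_eq hg hge
    rw [D.ψ_s_of_mem_closure J 1 hge, if_pos (liveSpan_congr J hK.symm),
      D.ψ_one_eq_zero hi (by omega), liveParallel_congr hK, sub_zero]
    have hlive : ∀ h, h ∉ N.closure ((insert e B : Finset α) : Set α) → h ∉ J →
        D.ψ (insert e B) J (D.δ * 1) = if Live N (insert h (insert e B)) J then 1 else 0 := by
      intro h hh hhJ
      rw [D.ψ_δ hN 1 hh hhJ, D.ψ_one_eq_zero hi (by omega),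
        D.ψ_one_eq_ite (insert_indep hN hi hh) (by rw [card_insert hN hh]; omega), zero_add]
    by_cases hP : LiveParallel N (insert e B) J
    · obtain ⟨h, hh, hhJ, hhL⟩ := id hP
      rw [hlive h hh hhJ, if_neg hhL, if_pos hP]
      norm_num
    · obtain ⟨h, hh, hhJ⟩ := id hLe
      rw [hlive h hh hhJ, if_neg hP, if_pos (by
        by_contra hcon
        exact hP ⟨h, hh, hhJ, hcon⟩)]
      norm_num
  · rw [D.ψ_s' hN J _ hge, D.ψ_one_eq_ite (insert_indep hN hi hge)
      (by rw [card_insert hN hge]; omega)]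
    by_cases hL : Live N (insert g (insert e B)) J
    · rw [if_pos hL]
      split_ifs with h1 h2 h3
      · refine absurd hL (not_live_insert hN h2 hge ?_)
        rw [h1]
        exact mem_liveSpan hN (by simp)
      all_goals norm_num
    · obtain ⟨h1, h2⟩ := liveParallel_of_not_live hN hLe hL
      rw [Finset.insert_comm] at hL
      obtain ⟨h3, h4⟩ := liveParallel_of_not_live hN hLg hL
      rw [if_neg (by rwa [Finset.insert_comm]), if_pos h1, if_pos h3,
        if_pos (by rw [h2, h4, Finset.insert_comm])]
      norm_num

lemma nonpos_of_card_add_three (hN : N.E = Set.univ)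
    {B J : Finset α} (hB : N.Indep (B : Set α)) (hL : Live N B J) (hBc : B.card + 3 = c)
    {w u : R} (hw : w ∈ D.V) (hu : u ∈ D.V) (hww : 0 < D.ψ B J (w * w))
    (h0 : D.ψ B J (w * u) = 0) : D.ψ B J (u * u) ≤ 0 := by
  obtain ⟨f, hf, hfJ⟩ := id hL
  set G : Finset α := {e | e ∉ N.closure (B : Set α)} with hG
  have hGm : ∀ {e}, e ∈ G → e ∉ N.closure (B : Set α) := fun he => by simpa [hG] using he
  have hcoord : ∀ {u}, u ∈ D.V → ∃ z : α → ℝ, ∀ X ∈ D.V,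
      D.ψ B J (u * X) = ∑ e ∈ G, z e * D.ψ B J (D.s e * X) := by
    intro u hu
    obtain ⟨a, d, z, hz⟩ := D.exists_coord (J := J) hf hu
    refine ⟨z, fun X hX => ?_⟩
    have hX : X ∈ D.V ^ 1 := by rwa [pow_one]
    rw [hz, D.ψ_b B _ hfJ, D.ψ_eq_zero_of_lt hN hX hB (by omega),
      D.ψ_eq_zero_of_lt hN hX hB (by omega), mul_zero, mul_zero, zero_add, zero_add]
  let A : α → ℝ := fun e => if Live N (insert e B) J then 1 else 0
  let P : α → ℝ := fun e => if LiveParallel N (insert e B) J then 1 else 0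
  let K : α → Set α := fun e => liveSpan N (insert e B) J
  have hmul : ∀ {u v : R}, ∀ {z y : α → ℝ}, v ∈ D.V →
      (∀ X ∈ D.V, D.ψ B J (u * X) = ∑ e ∈ G, z e * D.ψ B J (D.s e * X)) →
      (∀ X ∈ D.V, D.ψ B J (v * X) = ∑ e ∈ G, y e * D.ψ B J (D.s e * X)) →
      D.ψ B J (u * v) = (∑ e ∈ G, z e * A e) * (∑ e ∈ G, y e * A e) -
        ∑ k ∈ G.image K, (∑ e ∈ G with K e = k, z e * P e) *
          ∑ e ∈ G with K e = k, y e * P e := by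
    intro u v z y hv hz hy
    rw [hz v hv, ← sum_sum_ite_key, Finset.sum_mul, ← Finset.sum_sub_distrib]
    refine Finset.sum_congr rfl fun e he => ?_
    rw [mul_comm (D.s e), hy _ (D.s_mem e), Finset.mul_sum, Finset.mul_sum,
      ← Finset.sum_sub_distrib]
    refine Finset.sum_congr rfl fun g hg => ?_
    rw [mul_comm (D.s g), D.ψ_s_mul_s_of_card_add_three hN hB hBc (hGm he) (hGm hg)]
    change z e * (y g * (A e * A g - if K e = K g then P e * P g else 0)) = _
    split_ifs <;> ring
  obtain ⟨z, hz⟩ := hcoord hw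
  obtain ⟨y, hy⟩ := hcoord hu
  rw [hmul hw hz hz] at hww
  rw [hmul hu hz hy] at h0
  rw [hmul hu hy hy]
  exact sq_sub_sum_sq_nonpos _ hww h0

lemma lorentzian_zero (hN : N.E = Set.univ)
    (hc : ∀ B : Finset α, N.IsBase (B : Set α) → B.card = c) {a d : ℝ} {x : α → ℝ}
    (hx : PosCoord a d x) {B J : Finset α} (hB : N.Indep (B : Set α)) :
    D.Lorentzian (D.form a d x) 0 B J := by
  refine D.lorentzian_of_nonpos hN hc hx 0 hB fun hL hle u hu h0 => ?_
  simp only [pow_zero, one_mul] at h0 ⊢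
  obtain ⟨f, hf, -⟩ := id hL
  have hlt := card_lt_of_notMem_closure hN hc hB hf
  have hw := D.form_mem a d x
  have hpow := D.ψ_pow_form hN hc hx 2 (J := J) hB
  rw [pow_two] at hpow
  obtain h | h | h : B.card + 1 = c ∨ B.card + 2 = c ∨ B.card + 3 = c := by omega
  · exact D.nonpos_of_card_add_one hN hc hx hB hL h hu h0
  · have hpow1 := (D.ψ_pow_form hN hc hx 1 (J := J) hB).2 hL (by omega)
    rw [pow_one] at hpow1
    exact nonpos_of_isotropic _ D.V hw hpow1 hpow.1
      (fun v hv hv0 => D.nonpos_of_card_add_two hN hB hL h hv hv0) hu h0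
  · exact D.nonpos_of_card_add_three hN hB hL h hw hu (hpow.2 hL (by omega)) h0

lemma lorentzian (hN : N.E = Set.univ)
    (hc : ∀ B : Finset α, N.IsBase (B : Set α) → B.card = c) {a d : ℝ} {x : α → ℝ}
    (hx : PosCoord a d x) (p : ℕ) : ∀ {B J : Finset α}, N.Indep (B : Set α) →
    D.Lorentzian (D.form a d x) p B J := by
  induction p with
  | zero => exact fun hB => D.lorentzian_zero hN hc hx hB
  | succ p ih => exact fun hB => D.lorentzian_succ hN hc hx ih hB

end DegreeModel
end Base

section HVector
open scoped Classical
set_option linter.unusedSectionVars false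
variable {α : Type*} [Fintype α] {N : Matroid α} {c : ℕ} {R : Type*} [CommRing R] [Algebra ℝ R]

lemma continuous_map_add_smul_pow (L : R →ₗ[ℝ] ℝ) (u v : R) (q : ℕ) :
    Continuous fun t : ℝ => L ((u + t • v) ^ q) := by
  have h : ∀ t : ℝ, L ((u + t • v) ^ q) =
      ∑ m ∈ Finset.range (q + 1), t ^ (q - m) * L (u ^ m * v ^ (q - m) * (q.choose m : R)) := by
    intro t
    rw [add_pow, map_sum]
    refine Finset.sum_congr rfl fun m _ => ?_
    rw [_root_.smul_pow, mul_smul_comm, smul_mul_assoc, map_smul, smul_eq_mul]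
  simp only [h]
  fun_prop

namespace DegreeModel
variable (D : DegreeModel N c R)

lemma tendsto_ψ_form_pow (B J : Finset α) (q : ℕ) :
    Filter.Tendsto (fun t : ℝ => D.ψ B J (D.form t 1 (fun _ => t) ^ q)) (nhdsWithin 0 (Set.Ioi 0))
      (nhds (D.ψ B J (D.δ ^ q))) := by
  have h : ∀ t : ℝ, D.form t 1 (fun _ => t) = D.δ + t • (1 + ∑ e, (1 + D.s e)) := by
    intro t
    rw [form, one_smul, smul_add, Finset.smul_sum]
    abel
  have hcont := (continuous_map_add_smul_pow (D.ψ B J) D.δ (1 + ∑ e, (1 + D.s e)) q).tendsto 0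
  rw [zero_smul, add_zero] at hcont
  simp only [h]
  exact hcont.mono_left nhdsWithin_le_nhds

lemma posCoord_of_pos {t : ℝ} (ht : 0 < t) : PosCoord t 1 (fun _ : α => t) :=
  ⟨ht, one_pos, fun _ => ht⟩

lemma ψ_δ_pow_nonneg (hN : N.E = Set.univ)
    (hc : ∀ B : Finset α, N.IsBase (B : Set α) → B.card = c) {B J : Finset α}
    (hB : N.Indep (B : Set α)) (q : ℕ) : 0 ≤ D.ψ B J (D.δ ^ q) :=
  ge_of_tendsto (D.tendsto_ψ_form_pow B J q) <| by
    filter_upwards [self_mem_nhdsWithin] with t ht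
    exact (D.ψ_pow_form hN hc (posCoord_of_pos ht) q hB).1

lemma ψ_δ_pow_logConcave (hN : N.E = Set.univ)
    (hc : ∀ B : Finset α, N.IsBase (B : Set α) → B.card = c) {B J : Finset α}
    (hB : N.Indep (B : Set α)) (p : ℕ) :
    D.ψ B J (D.δ ^ p) * D.ψ B J (D.δ ^ (p + 2)) ≤ D.ψ B J (D.δ ^ (p + 1)) ^ 2 := by
  refine le_of_tendsto_of_tendsto
    ((D.tendsto_ψ_form_pow B J p).mul (D.tendsto_ψ_form_pow B J (p + 2)))
    ((D.tendsto_ψ_form_pow B J (p + 1)).pow 2) ?_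
  filter_upwards [self_mem_nhdsWithin] with t ht
  have := D.lorentzian hN hc (posCoord_of_pos ht) p hB (J := J) 1 D.one_mem
  rwa [mul_one, mul_one, mul_one, ← pow_two, ← pow_add, ← pow_succ] at this

end DegreeModel

variable {M : Matroid α} {d : ℕ}

lemma card_eq_of_isBase (hrank : matroidRank M Set.univ = d) {B : Finset α}
    (hB : M.IsBase (B : Set α)) : B.card = d := by
  rw [← hrank, matroidRank]
  have hmem : B.card ∈ {m | ∃ I ⊆ Set.univ, M.Indep I ∧ I.ncard = m} :=
    ⟨B, Set.subset_univ _, hB.indep, Set.ncard_coe_finset B⟩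
  refine (IsGreatest.csSup_eq ⟨hmem, ?_⟩).symm
  rintro _ ⟨I, -, hI, rfl⟩
  obtain ⟨B', hB', hIB⟩ := hI.exists_isBase_superset
  rw [← Set.ncard_coe_finset, hB.ncard_eq_ncard_of_isBase hB']
  exact Set.ncard_le_ncard hIB (Set.toFinite _)

lemma card_le_of_indep_of_rank (hrank : matroidRank M Set.univ = d) {I : Finset α}
    (hI : M.Indep (I : Set α)) : I.card ≤ d := by
  obtain ⟨B, hB, hIB⟩ := hI.exists_isBase_superset
  rw [← card_eq_of_isBase hrank (B := B.toFinset) (by simpa using hB)]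
  exact Finset.card_le_card fun x hx => by simpa using hIB hx

lemma rank_le_card (hrank : matroidRank M Set.univ = d) : d ≤ Fintype.card α := by
  obtain ⟨B, hB⟩ := M.exists_isBase
  rw [← card_eq_of_isBase hrank (B := B.toFinset) (by simpa using hB)]
  exact Finset.card_le_univ _

lemma card_eq_of_dual_isBase (hE : M.E = Set.univ) (hrank : matroidRank M Set.univ = d)
    {B : Finset α} (hB : M✶.IsBase (B : Set α)) : B.card = Fintype.card α - d := by
  have h := hB.compl_isBase_of_dual
  rw [hE, ← Set.compl_eq_univ_sdiff, ← Finset.coe_compl] at h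
  have := card_eq_of_isBase hrank h
  rw [Finset.card_compl] at this
  have := Finset.card_le_univ B
  omega

lemma dual_spanning_iff (hE : M.E = Set.univ) (S : Finset α) :
    M✶.Spanning (S : Set α) ↔ M.Indep ((Sᶜ : Finset α) : Set α) := by
  rw [Matroid.spanning_iff_compl_coindep (by simp [hE]), Matroid.coindep_def, Matroid.dual_dual,
    Matroid.dual_ground, hE, ← Set.compl_eq_univ_sdiff, Finset.coe_compl]

lemma indepCount_eq_card (M : Matroid α) (k : ℕ) :
    indepCount M k = Finset.card {I : Finset α | M.Indep (I : Set α) ∧ I.card = k} := by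
  rw [indepCount, ← Set.ncard_coe_finset,
    ← Set.ncard_image_of_injective _ (Finset.coe_injective (α := α))]
  congr 1
  ext I
  simp only [Set.mem_ofPred_eq, Finset.coe_filter, Finset.mem_univ, true_and, Set.mem_image]
  constructor
  · rintro ⟨h1, h2⟩
    exact ⟨I.toFinset, ⟨by simpa using h1, by rw [← h2, Set.ncard_eq_toFinset_card']⟩, by simp⟩
  · rintro ⟨J, ⟨h1, h2⟩, rfl⟩
    exact ⟨h1, by rwa [Set.ncard_coe_finset]⟩

/-- The spanning set polynomial of the dual in terms of independent sets. -/
lemma spanPoly_dual (hE : M.E = Set.univ) (hrank : matroidRank M Set.univ = d) :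
    spanPoly M✶ (Fintype.card α - d) ∅ ∅ =
      ∑ I ∈ (Finset.univ : Finset (Finset α)).filter (fun I : Finset α => M.Indep (I : Set α)),
        X ^ I.card * (1 - X) ^ (d - I.card) := by
  rw [spanPoly]
  have hd := rank_le_card hrank
  refine Finset.sum_nbij' (fun S : Finset α => Sᶜ) (fun S : Finset α => Sᶜ) ?_ ?_ ?_ ?_ ?_
  · intro S hS
    simpa [dual_spanning_iff hE] using hS
  · intro I hI
    simpa [dual_spanning_iff hE] using hI
  · simp
  · simp
  · intro S hS
    have hS' : M.Indep ((Sᶜ : Finset α) : Set α) := by simpa [dual_spanning_iff hE] using hS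
    have h1 := card_le_of_indep_of_rank hrank hS'
    rw [Finset.card_compl] at h1 ⊢
    have := Finset.card_le_univ S
    congr 2
    omega

lemma spanPoly_dual_eq_sum_indepCount (hE : M.E = Set.univ)
    (hrank : matroidRank M Set.univ = d) :
    spanPoly M✶ (Fintype.card α - d) ∅ ∅ =
      ∑ k ∈ Finset.range (d + 1), C (indepCount M k : ℝ) * (X ^ k * (1 - X) ^ (d - k)) := by
  rw [spanPoly_dual hE hrank]
  rw [← Finset.sum_fiberwise_of_maps_to (g := Finset.card) (t := Finset.range (d + 1))]
  · refine Finset.sum_congr rfl fun k _ => ?_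
    rw [Finset.sum_congr rfl (g := fun _ => X ^ k * (1 - X) ^ (d - k))
      fun I hI => by rw [(Finset.mem_filter.1 hI).2], Finset.sum_const, Finset.filter_filter,
      ← indepCount_eq_card, nsmul_eq_mul, map_natCast]
  · intro I hI
    have := card_le_of_indep_of_rank hrank (Finset.mem_filter.1 hI).2
    simpa [Nat.lt_succ_iff] using this

/-- Reversal of the polynomial identity defining the `h`-vector. -/
lemma sum_hvector_eq {h : ℕ → ℤ} {f : ℕ → ℕ}
    (hh : ∑ k ∈ Finset.range (d + 1), C (h k) * X ^ (d - k) =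
      ∑ k ∈ Finset.range (d + 1), C ((f k : ℤ)) * (X - 1) ^ (d - k)) :
    ∑ k ∈ Finset.range (d + 1), C (f k : ℝ) * (X ^ k * (1 - X) ^ (d - k)) =
      ∑ k ∈ Finset.range (d + 1), C (h k : ℝ) * X ^ k := by
  refine Polynomial.eq_of_infinite_eval_eq _ _ ((Set.Ioi_infinite (0 : ℝ)).mono fun y hy => ?_)
  have hy0 : y ≠ 0 := (Set.mem_Ioi.1 hy).ne'
  have h1 := congrArg (fun P : ℤ[X] => y ^ d * P.eval₂ (Int.castRingHom ℝ) y⁻¹) hh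
  simp only [eval₂_finsetSum, eval₂_mul, eval₂_C, eval₂_pow, eval₂_X, eval₂_sub, eval₂_one,
    Finset.mul_sum] at h1
  simp only [Set.mem_ofPred_eq, eval_finsetSum, eval_mul, eval_C, eval_pow, eval_X, eval_sub,
    eval_one]
  simp only [eq_intCast, Int.cast_natCast] at h1
  have hk : ∀ k ∈ Finset.range (d + 1), y ^ d = y ^ k * y ^ (d - k) := by
    intro k hk
    rw [← pow_add, Nat.add_sub_cancel' (Nat.lt_succ_iff.1 (Finset.mem_range.1 hk))]
  refine Eq.trans ?_ (h1.symm.trans ?_)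
  · refine Finset.sum_congr rfl fun k hkd => ?_
    have e1 : 1 - y = y * (y⁻¹ - 1) := by field_simp
    rw [hk k hkd, e1, mul_pow]; ring
  · refine Finset.sum_congr rfl fun k hkd => ?_
    rw [hk k hkd, inv_pow]
    field_simp

end HVector
end MatroidHVector

open MatroidHVector

/-- **Log-concavity of the h-vector of the independence complex.**
If `M` is a matroid of rank `d` on a finite ground set and `h` is the h-vector of its
independence complex, defined by `Σ_{k=0}^{d} h_k q^{d−k} = Σ_{k=0}^{d} f_k (q−1)^{d−k}`
where `f_k` is the number of independent sets of cardinality `k`, then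
`h_k ≥ 0` for all `0 ≤ k ≤ d` and `h_{k-1} h_{k+1} ≤ h_k ^ 2` for all `0 < k < d`. -/
theorem hvector_independence_logConcave {α : Type*} [Fintype α] (M : Matroid α)
    (hE : M.E = Set.univ) (d : ℕ) (hrank : matroidRank M Set.univ = d)
    (h : ℕ → ℤ)
    (hh : ∑ k ∈ Finset.range (d + 1), C (h k) * X ^ (d - k) =
      ∑ k ∈ Finset.range (d + 1), C ((indepCount M k : ℤ)) * (X - 1) ^ (d - k)) :
    (∀ k ≤ d, 0 ≤ h k) ∧
    (∀ k : ℕ, 0 < k → k < d → h (k - 1) * h (k + 1) ≤ h k ^ 2) := by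
  set c := Fintype.card α - d
  have hN : M✶.E = Set.univ := by rw [Matroid.dual_ground, hE]
  have hc : ∀ B : Finset α, M✶.IsBase (B : Set α) → B.card = c :=
    fun B hB => card_eq_of_dual_isBase hE hrank hB
  have hcoeff : ∀ k ≤ d, (spanPoly M✶ c ∅ ∅).coeff k = h k := by
    intro k hk
    rw [spanPoly_dual_eq_sum_indepCount hE hrank, sum_hvector_eq hh, finsetSum_coeff]
    simp only [coeff_C_mul, coeff_X_pow, mul_ite, mul_one, mul_zero, Finset.sum_ite_eq,
      Finset.mem_range]
    exact if_pos (Nat.lt_succ_of_le hk)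
  set D := flatModel hN hc
  have hempty : M✶.Indep ((∅ : Finset α) : Set α) := by simp
  have hψ : ∀ {k a : ℕ}, k ≤ d → a + 1 = k + c → D.ψ ∅ ∅ (D.δ ^ a) = h k := by
    intro k a hk ha
    rw [flatModel_ψ_dCls_pow, ha, coeff_X_pow_mul, hcoeff k hk]
  constructor
  · intro k hk
    rw [← Int.cast_nonneg_iff (R := ℝ)]
    by_cases h0 : k + c = 0
    · have hk0 : k = 0 := by omega
      rw [← hcoeff k hk, hk0, coeff_zero_eq_eval_zero, spanPoly, eval_finsetSum]
      refine Finset.sum_nonneg fun S _ => ?_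
      simp only [eval_mul, eval_pow, eval_X, eval_sub, eval_one, sub_zero, one_pow, mul_one]
      positivity
    · rw [← hψ hk (a := k + c - 1) (by omega)]
      exact D.ψ_δ_pow_nonneg hN hc hempty _
  · intro k hk hkd
    rcases Nat.eq_zero_or_pos c with h0 | h0
    · have hzero : (h (k + 1) : ℝ) = 0 := by
        rw [← hψ (a := k) hkd (by omega)]
        exact D.ψ_eq_zero_of_not_live hempty (not_live_of_card hN hc hempty (by simp [h0]))
          (D.pow_mem D.δ_mem k)
      rw [Int.cast_eq_zero.1 hzero, mul_zero]
      exact sq_nonneg _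
    · have := D.ψ_δ_pow_logConcave hN hc hempty (J := ∅) (k + c - 2)
      rw [hψ (k := k - 1) (a := k + c - 2) (by omega) (by omega),
        hψ (k := k) (a := k + c - 2 + 1) (by omega) (by omega),
        hψ (k := k + 1) (a := k + c - 2 + 2) (by omega) (by omega)] at this
      exact_mod_cast this
end

section
/- For every matroid M with finite ground set E and rank d, the h-vector of the independence complex of M is flawless: if d' is the largest index with h_{d'} ≠ 0 (assuming some h_k is nonzero), then h_k ≤ h_{d'−k} for all 0 ≤ k ≤ d'/2. -/
open Polynomial

open scoped Matroid

/-- The polynomial `Σ_I (q - 1)^(r - |I|)` over the independent sets `I` of `M`, where `r` is the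
rank of `M`; its coefficients are the entries of the h-vector in reverse order. -/
noncomputable def indepPoly {α : Type*} [Fintype α] (M : Matroid α) : ℤ[X] :=
  open Classical in
  ∑ I ∈ Finset.univ.filter (fun I : Finset α ↦ M.Indep (I : Set α)),
    (X - 1) ^ (M.eRank.toNat - I.card)

/-- The cone spanned by the interval sums `X^a + ⋯ + X^(a+b)` with center at most `d / 2`. -/
noncomputable def intervalCone (d : ℕ) : AddSubmonoid ℤ[X] :=
  AddSubmonoid.closure {p | ∃ a b, 2 * a + b ≤ d ∧ p = X ^ a * ∑ i ∈ Finset.range (b + 1), X ^ i}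

section Cone

lemma interval_mem_intervalCone {a b d : ℕ} (h : 2 * a + b ≤ d) :
    X ^ a * ∑ i ∈ Finset.range (b + 1), X ^ i ∈ intervalCone d :=
  AddSubmonoid.subset_closure ⟨a, b, h, rfl⟩

lemma intervalCone_mono {d e : ℕ} (h : d ≤ e) : intervalCone d ≤ intervalCone e := by
  refine AddSubmonoid.closure_mono ?_
  rintro p ⟨a, b, hab, rfl⟩
  exact ⟨a, b, hab.trans h, rfl⟩

lemma geom_mul_geom (m n : ℕ) :
    (∑ i ∈ Finset.range (m + 1), X ^ i) * (∑ i ∈ Finset.range (n + 1), X ^ i) =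
      (∑ i ∈ Finset.range (m + n + 1), X ^ i) +
        X * ((∑ i ∈ Finset.range m, X ^ i) * ∑ i ∈ Finset.range n, (X : ℤ[X]) ^ i) := by
  have hne : (X - 1 : ℤ[X]) ≠ 0 := by simpa using X_sub_C_ne_zero (1 : ℤ)
  apply mul_right_cancel₀ (mul_ne_zero hne hne)
  have h (k : ℕ) := geom_sum_mul (X : ℤ[X]) k
  linear_combination (∑ i ∈ Finset.range (n + 1), X ^ i) * (X - 1) * h (m + 1) +
    (X ^ (m + 1) - 1) * h (n + 1) - (X - 1) * h (m + n + 1) -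
    X * (∑ i ∈ Finset.range n, X ^ i) * (X - 1) * h m - X * (X ^ m - 1) * h n

lemma mul_interval_mem_intervalCone (m : ℕ) {a b d : ℕ} (h : 2 * a + b ≤ d) :
    (∑ i ∈ Finset.range (m + 1), X ^ i) * (X ^ a * ∑ i ∈ Finset.range (b + 1), X ^ i) ∈
      intervalCone (d + m) := by
  induction m generalizing a b d with
  | zero => simpa using interval_mem_intervalCone h
  | succ m ih =>
    rw [mul_left_comm, geom_mul_geom, mul_add]
    refine add_mem (interval_mem_intervalCone (by omega)) ?_
    cases b with
    | zero => simp
    | succ b =>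
      rw [← mul_assoc, ← pow_succ, mul_left_comm]
      exact intervalCone_mono (by omega) (ih (d := d + 1) (a := a + 1) (b := b) (by omega))

lemma geom_mul_mem_intervalCone (m : ℕ) {d : ℕ} {p : ℤ[X]} (hp : p ∈ intervalCone d) :
    (∑ i ∈ Finset.range (m + 1), X ^ i) * p ∈ intervalCone (d + m) := by
  induction hp using AddSubmonoid.closure_induction with
  | mem p hp =>
    obtain ⟨a, b, h, rfl⟩ := hp
    exact mul_interval_mem_intervalCone m h
  | zero => simp
  | add p q _ _ hp hq => rw [mul_add]; exact add_mem hp hq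

lemma coeff_interval (a b k : ℕ) :
    (X ^ a * ∑ i ∈ Finset.range (b + 1), X ^ i : ℤ[X]).coeff k =
      if a ≤ k ∧ k ≤ a + b then 1 else 0 := by
  simp only [coeff_X_pow_mul', finsetSum_coeff, coeff_X_pow, Finset.sum_ite_eq, Finset.mem_range]
  split_ifs <;> first | rfl | omega

lemma coeff_le_coeff_of_mem_intervalCone {d : ℕ} {p : ℤ[X]} (hp : p ∈ intervalCone d) {k : ℕ}
    (hk : 2 * k ≤ d) : p.coeff (d - k) ≤ p.coeff k := by
  induction hp using AddSubmonoid.closure_induction with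
  | mem p hp =>
    obtain ⟨a, b, h, rfl⟩ := hp
    simp only [coeff_interval]
    split_ifs <;> omega
  | zero => simp
  | add p q _ _ hp hq => simp only [coeff_add]; exact add_le_add hp hq

end Cone

section Rank

variable {α : Type*} {M : Matroid α}

lemma Matroid.IsBase.ncard_eq_toNat_eRank {B : Set α} (hB : M.IsBase B) :
    B.ncard = M.eRank.toNat := by
  rw [Set.ncard, hB.encard_eq_eRank]

lemma Matroid.Indep.ncard_le_toNat_eRank [Finite α] {I : Set α} (hI : M.Indep I) :
    I.ncard ≤ M.eRank.toNat := by
  obtain ⟨B, hB, hIB⟩ := hI.exists_isBase_superset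
  rw [← hB.ncard_eq_toNat_eRank]
  exact Set.ncard_le_ncard hIB

lemma Matroid.Indep.toNat_eRank_contract [Finite α] {I : Set α} (hI : M.Indep I) :
    M.eRank.toNat = (M ／ I).eRank.toNat + I.ncard := by
  obtain ⟨B, hB⟩ := (M ／ I).exists_isBase
  obtain ⟨hBI, hdj⟩ := hI.contract_isBase_iff.1 hB
  rw [← hB.ncard_eq_toNat_eRank, ← hBI.ncard_eq_toNat_eRank, Set.ncard_union_eq hdj]

lemma Matroid.toNat_eRank_deleteElem {e : α} (he : ¬ M.IsColoop e) :
    (M ＼ {e}).eRank.toNat = M.eRank.toNat := by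
  rw [isColoop_iff_forall_mem_isBase] at he
  push Not at he
  obtain ⟨B, hB, heB⟩ := he
  have hB' : (M ＼ {e}).IsBase B := by
    rw [delete_isBase_iff]
    exact hB.isBasis_ground.isBasis_subset
      (Set.subset_sdiff_singleton hB.subset_ground heB) Set.sdiff_subset
  rw [← hB.ncard_eq_toNat_eRank, ← hB'.ncard_eq_toNat_eRank]

lemma matroidRank_univ [Finite α] (M : Matroid α) :
    matroidRank M Set.univ = M.eRank.toNat := by
  obtain ⟨B, hB⟩ := M.exists_isBase
  refine IsGreatest.csSup_eq ⟨⟨B, B.subset_univ, hB.indep, hB.ncard_eq_toNat_eRank⟩, ?_⟩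
  rintro m ⟨I, -, hI, rfl⟩
  exact hI.ncard_le_toNat_eRank

end Rank

section SeriesClass

variable {α : Type*} {M : Matroid α}

/-- In a matroid without coloops, the element `e` together with the coloops of `M ＼ {e}` is a
series class: once one of its elements is avoided, the others behave like coloops. -/
lemma Matroid.indep_of_not_insert_coloops_subset (hM : M.coloops = ∅) {e : α} (he : e ∈ M.E)
    {I : Set α} (hI : ¬ insert e (M ＼ {e}).coloops ⊆ I)
    (hJ : (M ＼ {e}).Indep (I \ insert e (M ＼ {e}).coloops)) : M.Indep I := by
  set K := (M ＼ {e}).coloops with hK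
  have hJK : M.Indep (I \ insert e K ∪ K) :=
    ((union_indep_iff_indep_of_subset_coloops subset_rfl).2 hJ).of_delete
  have hIe : M.Indep (I \ {e}) := hJK.subset fun x hx ↦ by
    by_cases hxK : x ∈ K
    · exact .inr hxK
    · exact .inl ⟨hx.1, by simpa [hxK] using hx.2⟩
  by_cases heI : e ∈ I
  swap
  · rwa [Set.sdiff_singleton_eq_self heI] at hIe
  obtain ⟨f, hfS, hfI⟩ := Set.not_subset.1 hI
  have hfe : f ≠ e := by rintro rfl; exact hfI heI
  have hfK : f ∈ K := hfS.resolve_left hfe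
  obtain ⟨hfcl, hfE, -⟩ := (M.delete_isColoop_iff {e}).1 hfK
  have hecl : e ∉ M.closure ((M.E \ {e}) \ {f}) := by
    intro hecl
    have hfc : ¬ M.IsColoop f := by simp [isColoop_iff_mem_coloops, hM]
    rw [isColoop_iff_notMem_closure_compl hfE, not_not,
      show M.E \ {f} = insert e ((M.E \ {e}) \ {f}) by
        ext x
        by_cases hx : x = e
        · simp [hx, he, hfe.symm]
        · simp [hx],
      closure_insert_eq_of_mem_closure hecl] at hfc
    exact hfcl hfc
  have hsub : I \ {e} ⊆ (M.E \ {e}) \ {f} := fun x hx ↦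
    ⟨⟨hIe.subset_ground hx, hx.2⟩, by rintro rfl; exact hfI hx.1⟩
  have := hIe.insert_indep_iff.2
    (.inl ⟨he, fun h ↦ hecl (M.closure_subset_closure hsub h)⟩)
  rwa [Set.insert_sdiff_singleton, Set.insert_eq_of_mem heI] at this

end SeriesClass

section Poly

open Finset

variable {α : Type*} [Fintype α]

open Classical in
/-- If the independent sets `I` of `M` with trace `I ∩ S ∈ T` are exactly those for which `I \ S` is
independent in `N`, their contribution to `indepPoly M` factors through `indepPoly N`. -/
lemma sum_indep_inter_mem (M N : Matroid α) (S : Finset α) (T : Finset (Finset α)) (t : ℕ)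
    (hTS : ∀ A ∈ T, A ⊆ S) (hTt : ∀ A ∈ T, #A ≤ t)
    (hr : M.eRank.toNat = N.eRank.toNat + t)
    (hN : ∀ J : Finset α, N.Indep (J : Set α) → Disjoint J S)
    (hMN : ∀ I : Finset α, I ∩ S ∈ T →
      (M.Indep (I : Set α) ↔ N.Indep ((I \ S : Finset α) : Set α))) :
    ∑ I ∈ univ.filter (fun I : Finset α ↦ M.Indep (I : Set α) ∧ I ∩ S ∈ T),
        (X - 1 : ℤ[X]) ^ (M.eRank.toNat - #I) =
      (∑ A ∈ T, (X - 1) ^ (t - #A)) * indepPoly N := by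
  rw [indepPoly, sum_mul_sum, ← sum_product']
  have hsplit {A J : Finset α} (hA : A ∈ T) (hJ : N.Indep (J : Set α)) :
      (A ∪ J) ∩ S = A ∧ (A ∪ J) \ S = J := by
    have hd := hN J hJ
    rw [union_inter_distrib_right, inter_eq_left.2 (hTS A hA), disjoint_iff_inter_eq_empty.1 hd,
      union_empty, union_sdiff_distrib, sdiff_eq_empty_iff_subset.2 (hTS A hA), hd.sdiff_eq_left,
      empty_union]
    exact ⟨rfl, rfl⟩
  refine sum_nbij' (fun I ↦ (I ∩ S, I \ S)) (fun p ↦ p.1 ∪ p.2) ?_ ?_ ?_ ?_ ?_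
  · intro I hI
    simp only [mem_filter, mem_univ, true_and, mem_product] at hI ⊢
    exact ⟨hI.2, (hMN I hI.2).1 hI.1⟩
  · rintro ⟨A, J⟩ h
    simp only [mem_filter, mem_univ, true_and, mem_product] at h ⊢
    obtain ⟨h1, h2⟩ := hsplit h.1 h.2
    rw [hMN _ (by rw [h1]; exact h.1), h1, h2]
    exact ⟨h.2, h.1⟩
  · intro I _
    exact (union_comm _ _).trans (sdiff_union_inter I S)
  · rintro ⟨A, J⟩ h
    simp only [mem_filter, mem_univ, true_and, mem_product] at h
    exact Prod.ext (hsplit h.1 h.2).1 (hsplit h.1 h.2).2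
  · intro I hI
    simp only [mem_filter, mem_univ, true_and] at hI
    have h1 := hTt _ hI.2
    have h2 := ((hMN I hI.2).1 hI.1).ncard_le_toNat_eRank
    rw [Set.ncard_coe_finset] at h2
    have h3 := card_inter_add_card_sdiff I S
    rw [← pow_add]
    congr 1
    dsimp only
    omega

lemma sum_powerset_sub_one_pow {ι : Type*} (S : Finset ι) :
    ∑ A ∈ S.powerset, (X - 1 : ℤ[X]) ^ (#S - #A) = X ^ #S := by
  have h := sum_pow_mul_eq_add_pow (1 : ℤ[X]) (X - 1) S
  rw [add_sub_cancel] at h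
  simpa using h

lemma sum_ssubsets_sub_one_pow {ι : Type*} [DecidableEq ι] (S : Finset ι) :
    ∑ A ∈ S.ssubsets, (X - 1 : ℤ[X]) ^ (#S - 1 - #A) = ∑ i ∈ range #S, X ^ i := by
  have hne : (X - 1 : ℤ[X]) ≠ 0 := by simpa using X_sub_C_ne_zero (1 : ℤ)
  apply mul_right_cancel₀ hne
  have h := sum_powerset_sub_one_pow S
  rw [← insert_erase (mem_powerset_self S), sum_insert (notMem_erase _ _)] at h
  rw [geom_sum_mul, ← h, sum_mul, ssubsets]
  simp only [tsub_self, pow_zero, add_sub_cancel_left]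
  refine sum_congr rfl fun A hA ↦ ?_
  have := card_lt_card (mem_ssubsets.1 hA)
  rw [← pow_succ]
  congr 1
  omega

open Classical in
/-- Splitting off the series class of `e` in a matroid without coloops. -/
lemma indepPoly_eq_geom_mul_add (M : Matroid α) (hM : M.coloops = ∅) {e : α} (he : e ∈ M.E)
    {S : Finset α} (hS : (S : Set α) = insert e (M ＼ {e}).coloops) :
    indepPoly M = (∑ i ∈ range #S, X ^ i) * indepPoly ((M ＼ {e}) ／ (M ＼ {e}).coloops) +
      if M.Indep (S : Set α) then indepPoly (M ／ (S : Set α)) else 0 := by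
  set K := (M ＼ {e}).coloops with hK
  have heK : e ∉ K := fun h ↦ ((M ＼ {e}).coloops_subset_ground h).2 rfl
  have hcard : #S = K.ncard + 1 := by
    rw [← Set.ncard_coe_finset, hS, Set.ncard_insert_of_notMem heK]
  have hec : ¬ M.IsColoop e := by simp [Matroid.isColoop_iff_mem_coloops, hM]
  have hrank := (M ＼ {e}).coloops_indep.toNat_eRank_contract
  rw [M.toNat_eRank_deleteElem hec, ← hK] at hrank
  have hind : ∀ J : Set α, ((M ＼ {e}) ／ K).Indep J ↔ Disjoint J K ∧ (M ＼ {e}).Indep J := by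
    intro J
    rw [(M ＼ {e}).coloops_indep.contract_indep_iff, Matroid.union_coloops_indep_iff]
  rw [indepPoly, ← sum_filter_add_sum_filter_not _ (fun I ↦ I ∩ S ∈ S.ssubsets)]
  simp only [filter_filter]
  congr 1
  · rw [sum_indep_inter_mem M ((M ＼ {e}) ／ K) S S.ssubsets (#S - 1),
      sum_ssubsets_sub_one_pow S]
    · exact fun A hA ↦ (mem_ssubsets.1 hA).1
    · intro A hA
      have := card_lt_card (mem_ssubsets.1 hA)
      omega
    · omega
    · intro J hJ
      rw [← disjoint_coe, hS, Set.disjoint_insert_right]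
      rw [hind, Matroid.deleteElem_indep_iff] at hJ
      exact ⟨hJ.2.2, hJ.1⟩
    · intro I hI
      rw [hind, coe_sdiff, hS]
      constructor
      · intro h
        refine ⟨Set.disjoint_sdiff_left.mono_right (Set.subset_insert _ _), ?_⟩
        rw [Matroid.deleteElem_indep_iff]
        exact ⟨h.subset Set.sdiff_subset, by simp⟩
      · rintro ⟨-, h⟩
        refine M.indep_of_not_insert_coloops_subset hM he ?_ h
        rw [← hK, ← hS, coe_subset]
        intro hSI
        exact (mem_ssubsets.1 hI).ne (inter_eq_right.2 hSI)
  · have hiff (I : Finset α) : I ∩ S ∉ S.ssubsets ↔ I ∩ S ∈ ({S} : Finset (Finset α)) := by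
      rw [mem_ssubsets, mem_singleton, ssubset_iff_subset_ne]
      simp
    simp only [hiff]
    split_ifs with hSi
    · rw [sum_indep_inter_mem M (M ／ (S : Set α)) S {S} #S]
      · simp
      · simp
      · simp
      · rw [hSi.toNat_eRank_contract, Set.ncard_coe_finset]
      · intro J hJ
        rw [hSi.contract_indep_iff, disjoint_coe] at hJ
        exact hJ.1
      · intro I hI
        rw [mem_singleton, inter_eq_right] at hI
        rw [coe_sdiff, ← hSi.union_indep_iff_contract_indep,
          Set.union_eq_self_of_subset_left (coe_subset.2 hI)]
    · refine sum_eq_zero fun I hI ↦ absurd ?_ hSi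
      simp only [mem_filter, mem_univ, true_and, mem_singleton, inter_eq_right] at hI
      exact hI.1.subset (coe_subset.2 hI.2)

lemma indepPoly_eq_one_of_ground_eq_empty (M : Matroid α) (hM : M.E = ∅) : indepPoly M = 1 := by
  classical
  have h : univ.filter (fun I : Finset α ↦ M.Indep (I : Set α)) = {∅} := by
    ext I
    simp only [mem_filter, mem_univ, true_and, mem_singleton]
    constructor
    · intro h
      simpa [hM] using h.subset_ground
    · rintro rfl
      simp
  obtain ⟨B, hB⟩ := M.exists_isBase
  have hr := hB.ncard_eq_toNat_eRank
  rw [Set.subset_empty_iff.1 (hB.subset_ground.trans hM.subset), Set.ncard_empty] at hr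
  rw [indepPoly]
  convert sum_singleton (fun I : Finset α ↦ (X - 1 : ℤ[X]) ^ (M.eRank.toNat - #I)) ∅ using 2
  simp [← hr]

/-- For a matroid without coloops, `indepPoly M` lies in the interval cone and has positive
constant coefficient. -/
lemma indepPoly_mem_intervalCone (M : Matroid α) (hM : M.coloops = ∅) :
    indepPoly M ∈ intervalCone M.eRank.toNat ∧ 0 < (indepPoly M).coeff 0 := by
  classical
  induction hn : M.E.ncard using Nat.strong_induction_on generalizing M with
  | _ n ih =>
  obtain hE | ⟨e, he⟩ := M.E.eq_empty_or_nonempty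
  · rw [indepPoly_eq_one_of_ground_eq_empty M hE]
    exact ⟨by simpa using interval_mem_intervalCone (a := 0) (b := 0) (Nat.zero_le _), by simp⟩
  set K := (M ＼ {e}).coloops with hK
  have heK : e ∉ K := fun h ↦ ((M ＼ {e}).coloops_subset_ground h).2 rfl
  obtain ⟨S, hS⟩ : ∃ S : Finset α, (S : Set α) = insert e K :=
    ⟨(insert e K).toFinset, by simp⟩
  have hcard : #S = K.ncard + 1 := by
    rw [← Set.ncard_coe_finset, hS, Set.ncard_insert_of_notMem heK]
  have hec : ¬ M.IsColoop e := by simp [Matroid.isColoop_iff_mem_coloops, hM]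
  have hrank := (M ＼ {e}).coloops_indep.toNat_eRank_contract
  rw [M.toNat_eRank_deleteElem hec, ← hK] at hrank
  have hlt {N : Matroid α} (h : N.E ⊆ M.E) (h' : e ∉ N.E) : N.E.ncard < n :=
    hn ▸ Set.ncard_lt_ncard ⟨h, fun h'' ↦ h' (h'' he)⟩
  obtain ⟨hN, hN0⟩ := ih _ (hlt (N := (M ＼ {e}) ／ K)
    (Set.sdiff_subset.trans Set.sdiff_subset) (fun h ↦ h.1.2 rfl)) ((M ＼ {e}) ／ K)
    (by simp [← hK]) rfl
  obtain ⟨hQ, hQ0⟩ : (if M.Indep (S : Set α) then indepPoly (M ／ (S : Set α)) else 0) ∈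
      intervalCone M.eRank.toNat ∧
      0 ≤ (if M.Indep (S : Set α) then indepPoly (M ／ (S : Set α)) else 0).coeff 0 := by
    split_ifs with hSi
    · obtain ⟨h1, h2⟩ := ih _ (hlt (N := M ／ (S : Set α)) Set.sdiff_subset
        (fun h ↦ h.2 (by simp [hS]))) (M ／ (S : Set α)) (by simp [hM]) rfl
      exact ⟨intervalCone_mono (by rw [hSi.toNat_eRank_contract]; omega) h1, h2.le⟩
    · exact ⟨zero_mem _, by simp⟩
  rw [indepPoly_eq_geom_mul_add M hM he hS, hcard]
  constructor
  · refine add_mem ?_ hQ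
    rw [hrank]
    exact geom_mul_mem_intervalCone _ hN
  · rw [coeff_add, mul_coeff_zero, finsetSum_coeff]
    simp only [coeff_X_pow]
    rw [sum_eq_single 0 (by simp +contextual [eq_comm]) (by simp)]
    simpa using add_pos_of_pos_of_nonneg hN0 hQ0

lemma indepPoly_eq_X_pow_mul (M : Matroid α) :
    indepPoly M = X ^ M.coloops.ncard * indepPoly (M ／ M.coloops) := by
  classical
  obtain ⟨K, hK⟩ : ∃ K : Finset α, (K : Set α) = M.coloops := ⟨M.coloops.toFinset, by simp⟩
  have hKi : M.Indep (K : Set α) := hK ▸ M.coloops_indep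
  have h := sum_indep_inter_mem M (M ／ (K : Set α)) K K.powerset #K
    (fun A hA ↦ mem_powerset.1 hA) (fun A hA ↦ card_le_card (mem_powerset.1 hA))
    (by rw [hKi.toNat_eRank_contract, Set.ncard_coe_finset])
    (fun J hJ ↦ disjoint_coe.1 (hKi.contract_indep_iff.1 hJ).1)
    (fun I _ ↦ by
      rw [coe_sdiff, ← hKi.union_indep_iff_contract_indep, Set.union_comm,
        Matroid.union_indep_iff_indep_of_subset_coloops hK.subset])
  rw [sum_powerset_sub_one_pow] at h
  rw [← hK, Set.ncard_coe_finset, ← h, indepPoly]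
  simp

lemma sum_indepCount_eq_indepPoly (M : Matroid α) :
    ∑ k ∈ range (M.eRank.toNat + 1),
      C (indepCount M k : ℤ) * (X - 1) ^ (M.eRank.toNat - k) = indepPoly M := by
  classical
  rw [indepPoly, ← sum_fiberwise_of_maps_to (g := card) (t := range (M.eRank.toNat + 1))]
  · refine sum_congr rfl fun k _ ↦ ?_
    have hc : indepCount M k =
        #{I ∈ univ.filter (fun I : Finset α ↦ M.Indep (I : Set α)) | #I = k} := by
      rw [indepCount, ← Set.ncard_coe_finset,
        ← Set.ncard_image_of_injective _ (coe_injective (α := α))]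
      congr 1
      ext I
      simp only [Set.mem_ofPred_eq, Set.mem_image, coe_filter, mem_filter, mem_univ, true_and]
      constructor
      · rintro ⟨hI, hk⟩
        refine ⟨I.toFinset, ?_, Set.coe_toFinset I⟩
        rw [Set.coe_toFinset, ← Set.ncard_eq_toFinset_card']
        exact ⟨hI, hk⟩
      · rintro ⟨J, ⟨hJ, hk⟩, rfl⟩
        exact ⟨hJ, by simpa using hk⟩
    rw [sum_congr rfl (g := fun _ ↦ (X - 1 : ℤ[X]) ^ (M.eRank.toNat - k)), sum_const, hc]
    · simp
    · intro I hI
      rw [(mem_filter.1 hI).2]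
  · intro I hI
    have := (mem_filter.1 hI).2.ncard_le_toNat_eRank
    rw [Set.ncard_coe_finset] at this
    exact mem_range.2 (by omega)

end Poly

/-- **Flawlessness of the h-vector of the independence complex.**
If `M` is a matroid of rank `d` on a finite ground set, `h` is the h-vector of its
independence complex, defined by `Σ_{k=0}^{d} h_k q^{d−k} = Σ_{k=0}^{d} f_k (q−1)^{d−k}`
where `f_k` is the number of independent sets of cardinality `k`, and `d'` is the largest
index with `h d' ≠ 0`, then `h k ≤ h (d' - k)` for all `0 ≤ k ≤ d'/2`. -/
theorem hvector_independence_flawless {α : Type*} [Fintype α] (M : Matroid α)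
    (hE : M.E = Set.univ) (d : ℕ) (hrank : matroidRank M Set.univ = d)
    (h : ℕ → ℤ)
    (hh : ∑ k ∈ Finset.range (d + 1), C (h k) * X ^ (d - k) =
      ∑ k ∈ Finset.range (d + 1), C ((indepCount M k : ℤ)) * (X - 1) ^ (d - k))
    (d' : ℕ) (hd' : d' ≤ d) (hd0 : h d' ≠ 0) (hdmax : ∀ k ≤ d, h k ≠ 0 → k ≤ d') :
    ∀ k : ℕ, 2 * k ≤ d' → h k ≤ h (d' - k) := by
  rw [matroidRank_univ] at hrank
  subst hrank
  rw [sum_indepCount_eq_indepPoly, indepPoly_eq_X_pow_mul] at hh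
  have hr := M.coloops_indep.toNat_eRank_contract
  obtain ⟨hcone, hpos⟩ := indepPoly_mem_intervalCone (M ／ M.coloops) (by simp)
  set c := M.coloops.ncard
  set n := (M ／ M.coloops).eRank.toNat
  set P := indepPoly (M ／ M.coloops)
  have hcoeff {k : ℕ} (hk : k ≤ M.eRank.toNat) :
      h k = if k ≤ n then P.coeff (n - k) else 0 := by
    have := congrArg (fun p ↦ p.coeff (M.eRank.toNat - k)) hh
    simp only [finsetSum_coeff, coeff_C_mul, coeff_X_pow, coeff_X_pow_mul'] at this
    rw [Finset.sum_eq_single k] at this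
    · rw [if_pos rfl, mul_one] at this
      rw [this]
      split_ifs <;> first | omega | rfl | (congr 1; omega)
    · intro j hj hjk
      rw [Finset.mem_range] at hj
      rw [if_neg (by omega), mul_zero]
    · simp; omega
  have hn : n ≤ d' := by
    refine hdmax n (by omega) ?_
    rw [hcoeff (by omega), if_pos le_rfl, Nat.sub_self]
    exact hpos.ne'
  obtain rfl : d' = n := by
    refine le_antisymm ?_ hn
    by_contra hlt
    exact hd0 (by rw [hcoeff hd', if_neg hlt])
  intro k hk
  rw [hcoeff (by omega), hcoeff (by omega), if_pos (by omega), if_pos (by omega),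
    Nat.sub_sub_self (by omega)]
  exact coeff_le_coeff_of_mem_intervalCone hcone hk
end
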